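/- arXiv:2502.16067 — 2 statements merged into one kernel-verified Lean document; each statement's English description precedes it below -/
import Mathlib

section
/- Let g ∈ 𝔽_q[T] be monic of degree ≥ 1, ℓ ∈ 𝔽_q[T] monic with ℓ | g, and c ∈ 𝔽_q[T] with gcd(c,g) = 1; let χ be a primitive Dirichlet character modulo ℓ and c̄ any multiplicative inverse of c modulo g. Then for every u ∈ ℂ with 0 < |u| < 1/q, R_2(u;χ,c/g) = χ̄(−c)·(qu²)^{deg g − 1} · Σ_{λ ∈ 𝔽_q^×} B_λ(u;χ) · R_2(1/(qu); χ, λc̄/g), where B_λ(u;χ) := Kl_χ(−1,λ)/q − (τ(χ,−1) + τ(χ̄,λ))/(q(1 − qu)) + ((q−1)/(q(1 − qu)²))·1(χ is even), and R_2(·;χ,λc̄/g) is evaluated via its rational continuation; equivalently, the identity holds as an equality of rational functions of u. -/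
open Polynomial
open scoped Classical

noncomputable section

/-- The canonical additive character of a finite field `F`:
`e_q(y) = exp(2πi·Tr(y)/p)` where `p` is the characteristic. -/
def eChar (F : Type) [Field F] [Fintype F] (y : F) : ℂ :=
  letI : Algebra (ZMod (ringChar F)) F := ZMod.algebra F (ringChar F)
  Complex.exp (2 * Real.pi * Complex.I *
    ((Algebra.trace (ZMod (ringChar F)) F y).val : ℂ) / (ringChar F : ℂ))

variable {F : Type} [Field F] [Fintype F]

/-- `e(a/g) = e_q(coefficient of T^(deg g - 1) of (a mod g))`. -/
def eFrac (a g : Polynomial F) : ℂ :=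
  eChar F ((a % g).coeff (g.natDegree - 1))

/-- Number of monic divisors of a polynomial. -/
def dCount (f : Polynomial F) : ℕ :=
  Set.ncard {g : Polynomial F | g.Monic ∧ g ∣ f}

/-- `r_χ(f) = Σ_{g monic, g ∣ f} χ(g)`. -/
def rChi (χ : Polynomial F → ℂ) (f : Polynomial F) : ℂ :=
  ∑ᶠ g ∈ {g : Polynomial F | g.Monic ∧ g ∣ f}, χ g

/-- A Dirichlet character modulo `ℓ`: a function induced by a group homomorphism
`(F[T]/(ℓ))^× → ℂ^×`, extended by zero on non-coprime arguments. -/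
def IsDirichletChar (ℓ : Polynomial F) (χ : Polynomial F → ℂ) : Prop :=
  (∀ f g : Polynomial F, f % ℓ = g % ℓ → χ f = χ g) ∧
  (∀ f g : Polynomial F, χ (f * g) = χ f * χ g) ∧ χ 1 = 1 ∧
  ∀ f : Polynomial F, χ f = 0 ↔ ¬ IsCoprime f ℓ

/-- Primitivity: `χ` is not induced by a character modulo a proper (monic) divisor of `ℓ`. -/
def IsPrimitiveChar (ℓ : Polynomial F) (χ : Polynomial F → ℂ) : Prop :=
  IsDirichletChar ℓ χ ∧
  ∀ ℓ' : Polynomial F, ℓ'.Monic → ℓ' ∣ ℓ → ℓ' ≠ ℓ →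
    ¬ ∃ χ' : Polynomial F → ℂ, IsDirichletChar ℓ' χ' ∧
      ∀ f : Polynomial F, IsCoprime f ℓ → χ f = χ' f

/-- Complex conjugate character. -/
def conjChar (χ : Polynomial F → ℂ) : Polynomial F → ℂ := fun f => starRingEnd ℂ (χ f)

/-- `L(s,χ) = Σ_{f monic} χ(f)|f|^{-s}`, summed by degree. -/
def LFun (χ : Polynomial F → ℂ) (s : ℂ) : ℂ :=
  ∑' n : ℕ, (∑ᶠ f ∈ {f : Polynomial F | f.Monic ∧ f.natDegree = n}, χ f) *
    (Fintype.card F : ℂ) ^ (-(s * (n : ℂ)))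

/-- Gauss sum `G(χ) = Σ_{deg a < deg ℓ} χ(a)·e(a/ℓ)`. -/
def GSum (ℓ : Polynomial F) (χ : Polynomial F → ℂ) : ℂ :=
  ∑ᶠ a ∈ {a : Polynomial F | a.degree < ℓ.degree}, χ a * eFrac a ℓ

/-- Kloosterman sum over `F`. -/
def Kl2 (α β : F) : ℂ :=
  ∑ γ : Fˣ, eChar F (α * (γ : F) + β * ((γ⁻¹ : Fˣ) : F))

/-- Twisted Kloosterman sum over `F`. -/
def KlChi (χ : Polynomial F → ℂ) (α β : F) : ℂ :=
  ∑ γ : Fˣ, χ (Polynomial.C (γ : F)) * eChar F (α * (γ : F) + β * ((γ⁻¹ : Fˣ) : F))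

/-- Gauss sum of the restriction of `χ` to `F`. -/
def tauChi (χ : Polynomial F → ℂ) (α : F) : ℂ :=
  ∑ γ : Fˣ, χ (Polynomial.C (γ : F)) * eChar F (α * (γ : F))

/-- Generalized binomial coefficient `C(-m, j)`. -/
def negBinom (m j : ℕ) : ℤ :=
  if m = 0 then (if j = 0 then 1 else 0) else (-1) ^ j * (Nat.choose (m + j - 1) j)

/-- The coefficients `b_k(χ; λ, η₁, η₂)` of the Voronoi summation formula. -/
def bCoeff (χ : Polynomial F → ℂ) (lam : F) (η₁ η₂ k : ℕ) : ℂ :=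
  (-1 : ℂ) ^ (k - η₁ - η₂) * KlChi χ ((η₁ : F) - 1) ((1 - (η₂ : F)) * lam) *
    (if η₁ + η₂ ≤ k then (negBinom (η₁ + η₂) (k - η₁ - η₂) : ℂ) else 0)

/-- The untwisted coefficients `b_k(λ, η₁, η₂)`. -/
def bCoeffD (lam : F) (η₁ η₂ k : ℕ) : ℂ :=
  (-1 : ℂ) ^ (k - η₁ - η₂) * Kl2 ((η₁ : F) - 1) ((1 - (η₂ : F)) * lam) *
    (if η₁ + η₂ ≤ k then (negBinom (η₁ + η₂) (k - η₁ - η₂) : ℂ) else 0)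

/-- The series `Σ_{f monic} c(f)·u^{deg f}` (as a `tsum`). -/
def monicSeries (c : Polynomial F → ℂ) (u : ℂ) : ℂ :=
  ∑' f : {f : Polynomial F // f.Monic}, c f * u ^ (f : Polynomial F).natDegree

/-- `φ` is the rational continuation of the series `u ↦ Σ_{f monic} c(f)·u^{deg f}`:
it agrees with the (convergent) series on `‖u‖ < 1/q` and is a rational function. -/
def IsRatCont (c : Polynomial F → ℂ) (φ : ℂ → ℂ) : Prop :=
  (∃ P Q : Polynomial ℂ, IsCoprime P Q ∧ Q ≠ 0 ∧
    ∀ z : ℂ, Q.eval z ≠ 0 → φ z = P.eval z / Q.eval z) ∧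
  ∀ u : ℂ, ‖u‖ < 1 / (Fintype.card F) →
    HasSum (fun f : {f : Polynomial F // f.Monic} => c f * u ^ (f : Polynomial F).natDegree)
      (φ u)

end

/-- The factor `B_λ(u;ψ)` appearing in the functional equation of `R_2`. -/
noncomputable def BCoef {F : Type} [Field F] [Fintype F]
    (ψ : Polynomial F → ℂ) (lam : F) (u : ℂ) : ℂ :=
  KlChi ψ (-1) lam / (Fintype.card F : ℂ) -
    (tauChi ψ (-1) + tauChi (conjChar ψ) lam) /
      ((Fintype.card F : ℂ) * (1 - (Fintype.card F : ℂ) * u)) +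
    ((Fintype.card F : ℂ) - 1) /
      ((Fintype.card F : ℂ) * (1 - (Fintype.card F : ℂ) * u) ^ 2) *
      (if ∀ γ : Fˣ, ψ (Polynomial.C (γ : F)) = 1 then 1 else 0)

section TwistedFunctionalEquation

open AddChar

/-- The canonical additive character of a finite field, bundled. -/
noncomputable def eAddChar (F : Type) [Field F] [Fintype F] : AddChar F ℂ :=
  letI : Algebra (ZMod (ringChar F)) F := ZMod.algebra F (ringChar F)
  haveI : NeZero (ringChar F) := ⟨(CharP.char_is_prime F (ringChar F)).ne_zero⟩
  (ZMod.stdAddChar (N := ringChar F)).compAddMonoidHom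
    (Algebra.trace (ZMod (ringChar F)) F).toAddMonoidHom

theorem eAddChar_apply (F : Type) [Field F] [Fintype F] (y : F) :
    eAddChar F y = eChar F y := by
  have : NeZero (ringChar F) := ⟨(CharP.char_is_prime F (ringChar F)).ne_zero⟩
  simp [eAddChar, eChar, ZMod.stdAddChar_apply, ZMod.toCircle_apply]

theorem eAddChar_isPrimitive (F : Type) [Field F] [Fintype F] : (eAddChar F).IsPrimitive := by
  let _ : Algebra (ZMod (ringChar F)) F := ZMod.algebra F (ringChar F)
  have : NeZero (ringChar F) := ⟨(CharP.char_is_prime F (ringChar F)).ne_zero⟩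
  intro a ha
  obtain ⟨b, hb⟩ := FiniteField.trace_to_zmod_nondegenerate F ha
  refine ne_one_iff.2 ⟨b, fun h => hb ?_⟩
  apply ZMod.injective_stdAddChar (N := ringChar F)
  rw [AddChar.map_zero_eq_one]
  exact h

variable {F : Type} [Field F] [Fintype F]

theorem exists_eAddChar_mul_ne_one {a : F} (ha : a ≠ 0) : ∃ s : F, eAddChar F (a * s) ≠ 1 :=
  ne_one_iff.1 (eAddChar_isPrimitive F ha)

theorem sum_units_eAddChar : ∑ γ : Fˣ, eAddChar F γ = -1 := by
  have h := sum_eq_zero_of_ne_one (ψ := eAddChar F)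
    (by simpa using eAddChar_isPrimitive F (one_ne_zero (α := F)))
  rw [Fintype.sum_eq_add_sum_compl 0, AddChar.map_zero_eq_one] at h
  rw [← eq_neg_iff_add_eq_zero.2 ((add_comm _ _).trans h)]
  refine Finset.sum_bij (fun γ _ => (γ : F)) (by simp) (fun _ _ _ _ => Units.ext)
    (fun b hb => ?_) (fun _ _ => rfl)
  exact ⟨Units.mk0 b (by simpa using hb), Finset.mem_univ _, rfl⟩

noncomputable instance degreeLTFintype (n : ℕ) : Fintype (degreeLT F n) :=
  haveI : Finite (degreeLT F n) := Finite.of_equiv _ (degreeLTEquiv F n).toEquiv.symm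
  Fintype.ofFinite _

theorem card_degreeLT (n : ℕ) : Fintype.card (degreeLT F n) = Fintype.card F ^ n := by
  rw [Fintype.card_congr (degreeLTEquiv F n).toEquiv]
  simp

variable {g : Polynomial F}

@[reducible]
noncomputable def adjoinRootFintype (hg : g.Monic) : Fintype (AdjoinRoot g) :=
  haveI : Module.Finite F (AdjoinRoot g) := hg.finite_adjoinRoot
  haveI : Finite (AdjoinRoot g) := Module.finite_of_finite F
  Fintype.ofFinite _

theorem card_adjoinRoot (hg : g.Monic) [Fintype (AdjoinRoot g)] :
    Fintype.card (AdjoinRoot g) = Fintype.card F ^ g.natDegree := by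
  have : Module.Finite F (AdjoinRoot g) := hg.finite_adjoinRoot
  rw [Module.card_eq_pow_finrank (K := F), (AdjoinRoot.powerBasis' hg).finrank]
  simp

/-- The character `x ↦ e(x / g)` on residues modulo `g`. -/
noncomputable def fracChar (hg : g.Monic) : AddChar (AdjoinRoot g) ℂ :=
  (eAddChar F).compAddMonoidHom
    ((Polynomial.lcoeff F (g.natDegree - 1)).comp (AdjoinRoot.modByMonicHom hg)).toAddMonoidHom

theorem fracChar_apply (hg : g.Monic) (x : AdjoinRoot g) :
    fracChar hg x = eAddChar F ((AdjoinRoot.modByMonicHom hg x).coeff (g.natDegree - 1)) := rfl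

theorem fracChar_mk (hg : g.Monic) (a : Polynomial F) :
    fracChar hg (AdjoinRoot.mk g a) = eFrac a g := by
  rw [fracChar_apply, AdjoinRoot.modByMonicHom_mk, modByMonic_eq_mod _ hg, eAddChar_apply, eFrac]

theorem fracChar_mk_of_degree_lt (hg : g.Monic) {a : Polynomial F} (ha : a.degree < g.degree) :
    fracChar hg (AdjoinRoot.mk g a) = eAddChar F (a.coeff (g.natDegree - 1)) := by
  rw [fracChar_apply, AdjoinRoot.modByMonicHom_mk, (modByMonic_eq_self_iff hg).2 ha]

theorem degree_modByMonicHom_lt {F : Type} [Field F] {g : F[X]} (hg : g.Monic) (x : AdjoinRoot g) :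
    (AdjoinRoot.modByMonicHom hg x).degree < g.degree := by
  obtain ⟨a, rfl⟩ := AdjoinRoot.mk_surjective x
  rw [AdjoinRoot.modByMonicHom_mk]
  exact degree_modByMonic_lt _ hg

theorem mk_modByMonicHom {F : Type} [Field F] {g : F[X]} (hg : g.Monic) (x : AdjoinRoot g) :
    AdjoinRoot.mk g (AdjoinRoot.modByMonicHom hg x) = x :=
  AdjoinRoot.mk_leftInverse hg x

theorem modByMonicHom_ne_zero {F : Type} [Field F] {g : F[X]} (hg : g.Monic) {x : AdjoinRoot g} (hx : x ≠ 0) :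
    AdjoinRoot.modByMonicHom hg x ≠ 0 := by
  intro h
  apply hx
  rw [← mk_modByMonicHom hg x, h, map_zero]

theorem natDegree_modByMonicHom_lt {F : Type} [Field F] {g : F[X]} (hg : g.Monic) (hgdeg : 1 ≤ g.natDegree) (x : AdjoinRoot g) :
    (AdjoinRoot.modByMonicHom hg x).natDegree < g.natDegree := by
  by_cases h : AdjoinRoot.modByMonicHom hg x = 0
  · rw [h, natDegree_zero]
    exact hgdeg
  · exact natDegree_lt_natDegree h (degree_modByMonicHom_lt hg x)

theorem X_pow_add_degreeLT_degree_lt {F : Type} [Field F] {g : F[X]} (hg : g.Monic) {n : ℕ} (hn : n < g.natDegree)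
    (p : degreeLT F n) : (X ^ n + (p : F[X])).degree < g.degree := by
  rw [degree_eq_natDegree hg.ne_zero]
  refine lt_of_le_of_lt (degree_add_le _ _) (max_lt ?_ ?_)
  · rw [degree_X_pow]
    exact_mod_cast hn
  · exact (mem_degreeLT.1 p.2).trans (by exact_mod_cast hn)

/-- Summation over monic residues, sorted by degree. -/
theorem sum_monic_residues (hg : g.Monic) (hgdeg : 1 ≤ g.natDegree) [Fintype (AdjoinRoot g)]
    (f : AdjoinRoot g → ℂ) :
    ∑ y : AdjoinRoot g, (if (AdjoinRoot.modByMonicHom hg y).Monic then f y else 0) =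
      ∑ n ∈ Finset.range g.natDegree, ∑ p : degreeLT F n,
        f (AdjoinRoot.mk g (X ^ n + (p : F[X]))) := by
  have hrep : ∀ n < g.natDegree, ∀ p : degreeLT F n,
      AdjoinRoot.modByMonicHom hg (AdjoinRoot.mk g (X ^ n + (p : F[X]))) = X ^ n + (p : F[X]) := by
    intro n hn p
    rw [AdjoinRoot.modByMonicHom_mk, modByMonic_eq_self_iff hg]
    exact X_pow_add_degreeLT_degree_lt hg hn p
  have hmonic : ∀ (n : ℕ) (p : degreeLT F n),
      (X ^ n + (p : F[X])).Monic ∧ (X ^ n + (p : F[X])).natDegree = n :=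
    fun n p => ((monicEquivDegreeLT n).symm p).2
  rw [← Finset.sum_filter, Finset.sum_sigma']
  symm
  refine Finset.sum_bij (fun a _ => AdjoinRoot.mk g (X ^ a.1 + (a.2 : F[X]))) ?_ ?_ ?_ ?_
  · rintro ⟨n, p⟩ h
    have hn : n < g.natDegree := by simpa using h
    rw [Finset.mem_filter, hrep n hn p]
    exact ⟨Finset.mem_univ _, (hmonic n p).1⟩
  · rintro ⟨n, p⟩ h ⟨m, r⟩ h' he
    have hn : n < g.natDegree := by simpa using h
    have hm : m < g.natDegree := by simpa using h'
    have he' := congrArg (AdjoinRoot.modByMonicHom hg) he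
    simp only [hrep n hn p, hrep m hm r] at he'
    have hnm : n = m := by rw [← (hmonic n p).2, ← (hmonic m r).2, he']
    subst hnm
    congr 1
    exact Subtype.ext (add_left_cancel he')
  · intro y hy
    have hy' : (AdjoinRoot.modByMonicHom hg y).Monic := by simpa using hy
    refine ⟨⟨(AdjoinRoot.modByMonicHom hg y).natDegree, monicEquivDegreeLT _ ⟨_, hy', rfl⟩⟩, ?_, ?_⟩
    · simpa using natDegree_modByMonicHom_lt hg hgdeg y
    · have h := congrArg Subtype.val ((monicEquivDegreeLT (R := F) _).symm_apply_apply
        ⟨AdjoinRoot.modByMonicHom hg y, hy', rfl⟩)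
      have h' : X ^ (AdjoinRoot.modByMonicHom hg y).natDegree +
          ((monicEquivDegreeLT (R := F) _ ⟨AdjoinRoot.modByMonicHom hg y, hy', rfl⟩ :
            degreeLT F _) : F[X]) = AdjoinRoot.modByMonicHom hg y := h
      simp only [h', mk_modByMonicHom]
  · intro a _
    rfl

theorem fracChar_mul_mk_eq_one (hg : g.Monic) (hgdeg : 1 ≤ g.natDegree) (x : AdjoinRoot g)
    {y : F[X]} (h : (AdjoinRoot.modByMonicHom hg x * y).degree < ((g.natDegree - 1 : ℕ) : WithBot ℕ)) :
    fracChar hg (x * AdjoinRoot.mk g y) = 1 := by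
  rw [← mk_modByMonicHom hg x, ← map_mul, fracChar_mk_of_degree_lt hg, coeff_eq_zero_of_degree_lt h,
    AddChar.map_zero_eq_one]
  refine h.trans ?_
  rw [degree_eq_natDegree hg.ne_zero]
  exact_mod_cast Nat.sub_lt hgdeg one_pos

theorem fracChar_mul_mk_monomial (hg : g.Monic) (hgdeg : 1 ≤ g.natDegree) (x : AdjoinRoot g)
    {n : ℕ} (hn : (AdjoinRoot.modByMonicHom hg x).natDegree + n = g.natDegree - 1) (s : F) :
    fracChar hg (x * AdjoinRoot.mk g (monomial n s)) =
      eAddChar F ((AdjoinRoot.modByMonicHom hg x).leadingCoeff * s) := by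
  set r := AdjoinRoot.modByMonicHom hg x with hr
  rw [← mk_modByMonicHom hg x, ← map_mul, fracChar_mk_of_degree_lt hg, ← hn, ← hr,
    coeff_mul_monomial, coeff_natDegree]
  refine lt_of_le_of_lt degree_le_natDegree ?_
  rw [degree_eq_natDegree hg.ne_zero]
  have h : (r * monomial n s).natDegree ≤ r.natDegree + n :=
    natDegree_mul_le.trans (Nat.add_le_add_left (natDegree_monomial_le s) _)
  exact_mod_cast (show (r * monomial n s).natDegree < g.natDegree by omega)

/-- The restriction of `y ↦ e(xy/g)` to polynomials of degree less than `n`. -/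
noncomputable def degreeLTChar (hg : g.Monic) (x : AdjoinRoot g) (n : ℕ) :
    AddChar (degreeLT F n) ℂ :=
  ((fracChar hg).mulShift x).compAddMonoidHom
    ((AdjoinRoot.mk g).toAddMonoidHom.comp (degreeLT F n).subtype.toAddMonoidHom)

theorem degreeLTChar_apply (hg : g.Monic) (x : AdjoinRoot g) (n : ℕ) (p : degreeLT F n) :
    degreeLTChar hg x n p = fracChar hg (x * AdjoinRoot.mk g (p : F[X])) := rfl

theorem sum_fracChar_monic (hg : g.Monic) (x : AdjoinRoot g) (n : ℕ) :
    ∑ p : degreeLT F n, fracChar hg (x * AdjoinRoot.mk g (X ^ n + (p : F[X]))) =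
      fracChar hg (x * AdjoinRoot.mk g (X ^ n)) * ∑ p, degreeLTChar hg x n p := by
  simp_rw [map_add, mul_add, AddChar.map_add_eq_mul, Finset.mul_sum, degreeLTChar_apply]

theorem degreeLTChar_sum_of_le (hg : g.Monic) (hgdeg : 1 ≤ g.natDegree) {x : AdjoinRoot g} {n : ℕ}
    (hn : (AdjoinRoot.modByMonicHom hg x).natDegree + n ≤ g.natDegree - 1) :
    ∑ p, degreeLTChar hg x n p = (Fintype.card F : ℂ) ^ n := by
  have h : ∀ p : degreeLT F n, degreeLTChar hg x n p = 1 := by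
    intro p
    rw [degreeLTChar_apply]
    apply fracChar_mul_mk_eq_one hg hgdeg
    by_cases hx : AdjoinRoot.modByMonicHom hg x = 0
    · rw [hx, zero_mul, degree_zero]
      exact WithBot.bot_lt_coe _
    by_cases hp : (p : F[X]) = 0
    · rw [hp, mul_zero, degree_zero]
      exact WithBot.bot_lt_coe _
    have h1 := (natDegree_lt_iff_degree_lt hp).2 (mem_degreeLT.1 p.2)
    rw [degree_mul, degree_eq_natDegree hx, degree_eq_natDegree hp]
    exact_mod_cast (by omega : (AdjoinRoot.modByMonicHom hg x).natDegree + (p : F[X]).natDegree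
      < g.natDegree - 1)
  simp [h, card_degreeLT]

theorem degreeLTChar_sum_of_lt (hg : g.Monic) (hgdeg : 1 ≤ g.natDegree) {x : AdjoinRoot g}
    (hx : x ≠ 0) {n : ℕ}
    (hn : g.natDegree - 1 < (AdjoinRoot.modByMonicHom hg x).natDegree + n) :
    ∑ p, degreeLTChar hg x n p = 0 := by
  apply sum_eq_zero_of_ne_one
  obtain ⟨s, hs⟩ := exists_eAddChar_mul_ne_one
    (leadingCoeff_ne_zero.2 (modByMonicHom_ne_zero hg hx))
  have hlt := natDegree_modByMonicHom_lt hg hgdeg x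
  set k := (AdjoinRoot.modByMonicHom hg x).natDegree with hk
  refine ne_one_iff.2 ⟨⟨monomial (g.natDegree - 1 - k) s, mem_degreeLT.2 ?_⟩, ?_⟩
  · refine lt_of_le_of_lt (degree_monomial_le _ _) ?_
    exact_mod_cast (by omega : g.natDegree - 1 - k < n)
  · rw [degreeLTChar_apply]
    rwa [fracChar_mul_mk_monomial hg hgdeg x (by omega)]

/-- The part of the series over the progression `x mod g` contributed by the reduced residue. -/
noncomputable def monicPart (hg : g.Monic) (u : ℂ) (x : AdjoinRoot g) : ℂ :=
  if (AdjoinRoot.modByMonicHom hg x).Monic then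
    u ^ (AdjoinRoot.modByMonicHom hg x).natDegree else 0

/-- The rational function `Σ_{f ≡ x mod g} u^(deg f)`, summed over monic `f`. -/
noncomputable def progSeries (hg : g.Monic) (u : ℂ) (x : AdjoinRoot g) : ℂ :=
  monicPart hg u x + u ^ g.natDegree / (1 - Fintype.card F * u)

theorem sum_fracChar_mul_monicPart (hg : g.Monic) (hgdeg : 1 ≤ g.natDegree)
    [Fintype (AdjoinRoot g)] (u : ℂ) (x : AdjoinRoot g) :
    ∑ y, fracChar hg (x * y) * monicPart hg u y =
      ∑ n ∈ Finset.range g.natDegree,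
        u ^ n * (fracChar hg (x * AdjoinRoot.mk g (X ^ n)) * ∑ p, degreeLTChar hg x n p) := by
  simp only [monicPart, mul_ite, mul_zero]
  rw [sum_monic_residues hg hgdeg]
  refine Finset.sum_congr rfl fun n hn => ?_
  rw [← sum_fracChar_monic, Finset.mul_sum]
  refine Finset.sum_congr rfl fun p _ => ?_
  rw [mul_comm, AdjoinRoot.modByMonicHom_mk, (modByMonic_eq_self_iff hg).2
    (X_pow_add_degreeLT_degree_lt hg (Finset.mem_range.1 hn) p)]
  have h := ((monicEquivDegreeLT n).symm p).2.2
  have h' : (X ^ n + (p : F[X])).natDegree = n := h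
  rw [h']

theorem sum_fracChar_mul_monicPart_zero (hg : g.Monic) (hgdeg : 1 ≤ g.natDegree)
    [Fintype (AdjoinRoot g)] (u : ℂ) :
    ∑ y, fracChar hg (0 * y) * monicPart hg u y =
      ∑ n ∈ Finset.range g.natDegree, (Fintype.card F * u : ℂ) ^ n := by
  rw [sum_fracChar_mul_monicPart hg hgdeg]
  refine Finset.sum_congr rfl fun n hn => ?_
  have hn' := Finset.mem_range.1 hn
  rw [degreeLTChar_sum_of_le hg hgdeg (by rw [map_zero, natDegree_zero]; omega), zero_mul,
    AddChar.map_zero_eq_one, one_mul, mul_pow, mul_comm]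

theorem sum_fracChar_mul_monicPart_of_ne_zero (hg : g.Monic) (hgdeg : 1 ≤ g.natDegree)
    [Fintype (AdjoinRoot g)] (u : ℂ) {x : AdjoinRoot g} (hx : x ≠ 0) {k : ℕ}
    (hk : (AdjoinRoot.modByMonicHom hg x).natDegree + k = g.natDegree - 1) :
    ∑ y, fracChar hg (x * y) * monicPart hg u y =
      ∑ n ∈ Finset.range k, (Fintype.card F * u : ℂ) ^ n +
        (Fintype.card F * u : ℂ) ^ k *
          eAddChar F (AdjoinRoot.modByMonicHom hg x).leadingCoeff := by
  rw [sum_fracChar_mul_monicPart hg hgdeg, ← Finset.sum_range_add_sum_Ico _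
    (show k + 1 ≤ g.natDegree by omega), Finset.sum_range_succ]
  have hrange : ∀ n ∈ Finset.range k,
      u ^ n * (fracChar hg (x * AdjoinRoot.mk g (X ^ n)) * ∑ p, degreeLTChar hg x n p) =
        (Fintype.card F * u : ℂ) ^ n := by
    intro n hn
    have hn' := Finset.mem_range.1 hn
    rw [degreeLTChar_sum_of_le hg hgdeg (by omega), fracChar_mul_mk_eq_one hg hgdeg, one_mul,
      mul_pow, mul_comm]
    rw [degree_mul, degree_X_pow, degree_eq_natDegree (modByMonicHom_ne_zero hg hx)]
    exact_mod_cast (by omega : (AdjoinRoot.modByMonicHom hg x).natDegree + n < g.natDegree - 1)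
  have hIco : ∀ n ∈ Finset.Ico (k + 1) g.natDegree,
      u ^ n * (fracChar hg (x * AdjoinRoot.mk g (X ^ n)) * ∑ p, degreeLTChar hg x n p) = 0 := by
    intro n hn
    have hn' := Finset.mem_Ico.1 hn
    rw [degreeLTChar_sum_of_lt hg hgdeg hx (by omega), mul_zero, mul_zero]
  rw [Finset.sum_congr rfl hrange, Finset.sum_eq_zero hIco, add_zero,
    degreeLTChar_sum_of_le hg hgdeg hk.le, ← monomial_one_right_eq_X_pow,
    fracChar_mul_mk_monomial hg hgdeg x hk, mul_one, mul_pow]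
  ring

theorem fracChar_isPrimitive (hg : g.Monic) (hgdeg : 1 ≤ g.natDegree) :
    (fracChar hg).IsPrimitive := by
  intro x hx
  obtain ⟨s, hs⟩ := exists_eAddChar_mul_ne_one
    (leadingCoeff_ne_zero.2 (modByMonicHom_ne_zero hg hx))
  have hlt := natDegree_modByMonicHom_lt hg hgdeg x
  refine ne_one_iff.2 ⟨AdjoinRoot.mk g (monomial (g.natDegree - 1 -
    (AdjoinRoot.modByMonicHom hg x).natDegree) s), ?_⟩
  rwa [mulShift_apply, fracChar_mul_mk_monomial hg hgdeg x (by omega)]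

theorem monicPart_smul {F : Type} [Field F] {g : F[X]} (hg : g.Monic) (u : ℂ) (x : AdjoinRoot g) (γ : Fˣ) :
    monicPart hg u (((γ⁻¹ : Fˣ) : F) • x) =
      if (γ : F) = (AdjoinRoot.modByMonicHom hg x).leadingCoeff then
        u ^ (AdjoinRoot.modByMonicHom hg x).natDegree else 0 := by
  have hγ : ((γ⁻¹ : Fˣ) : F) ≠ 0 := Units.ne_zero _
  have hiff : (((γ⁻¹ : Fˣ) : F) • AdjoinRoot.modByMonicHom hg x).Monic ↔
      (γ : F) = (AdjoinRoot.modByMonicHom hg x).leadingCoeff := by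
    rw [Monic.def, leadingCoeff, natDegree_smul _ hγ, coeff_smul, smul_eq_mul, coeff_natDegree,
      Units.val_inv_eq_inv_val, inv_mul_eq_one₀ (Units.ne_zero γ)]
  simp only [monicPart, map_smul, natDegree_smul _ hγ, hiff]

/-- The weights relating a progression series to its Fourier dual. -/
noncomputable def dualWeight (u : ℂ) (a : F) : ℂ :=
  eAddChar F a - 1 / (1 - Fintype.card F * u)

theorem sum_dualWeight {u : ℂ} (hu : 1 - (Fintype.card F : ℂ) * u ≠ 0) :
    ∑ γ : Fˣ, dualWeight u (γ : F) =
      -(Fintype.card F * (1 - u)) / (1 - Fintype.card F * u) := by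
  have hcard : (Fintype.card Fˣ : ℂ) = Fintype.card F - 1 := by
    rw [Fintype.card_units, Nat.cast_sub Fintype.card_pos, Nat.cast_one]
  simp only [dualWeight, Finset.sum_sub_distrib, sum_units_eAddChar, Finset.sum_const,
    Finset.card_univ, nsmul_eq_mul, hcard]
  field_simp
  ring

theorem sum_dualWeight_mul_monicPart (hg : g.Monic) (u v : ℂ) {x : AdjoinRoot g} (hx : x ≠ 0) :
    ∑ γ : Fˣ, dualWeight u (γ : F) * monicPart hg v (((γ⁻¹ : Fˣ) : F) • x) =
      dualWeight u (AdjoinRoot.modByMonicHom hg x).leadingCoeff *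
        v ^ (AdjoinRoot.modByMonicHom hg x).natDegree := by
  rw [Finset.sum_eq_single (Units.mk0 _
    (leadingCoeff_ne_zero.2 (modByMonicHom_ne_zero hg hx)))]
  · rw [monicPart_smul hg v x, if_pos (Units.val_mk0 _), Units.val_mk0]
  · intro γ _ hγ
    rw [monicPart_smul hg v x, if_neg (fun h => hγ (Units.ext (by rw [h, Units.val_mk0]))),
      mul_zero]
  · simp

/-- Functional equation of the progression series: the Fourier transform at `u` in terms of the
values at `1 / (q u)`. -/
theorem sum_fracChar_mul_progSeries (hg : g.Monic) (hgdeg : 1 ≤ g.natDegree)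
    [Fintype (AdjoinRoot g)] {u : ℂ} (hu0 : u ≠ 0) (hu1 : u ≠ 1)
    (hu : 1 - (Fintype.card F : ℂ) * u ≠ 0) (x : AdjoinRoot g) :
    ∑ y, fracChar hg (x * y) * progSeries hg u y =
      (Fintype.card F * u : ℂ) ^ (g.natDegree - 1) *
        ∑ γ : Fˣ, dualWeight u (γ : F) *
          progSeries hg (1 / (Fintype.card F * u)) (((γ⁻¹ : Fˣ) : F) • x) := by
  have hq : (Fintype.card F : ℂ) ≠ 0 := Nat.cast_ne_zero.2 Fintype.card_ne_zero
  have hu1' : (1 : ℂ) - u ≠ 0 := sub_ne_zero.2 hu1.symm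
  have hu1'' : u - 1 ≠ 0 := sub_ne_zero.2 hu1
  have hqu : (Fintype.card F : ℂ) * u ≠ 1 := fun h => hu (by rw [h, sub_self])
  have hqu' : (Fintype.card F : ℂ) * u - 1 ≠ 0 := sub_ne_zero.2 hqu
  obtain ⟨d, hd⟩ : ∃ d, g.natDegree = d + 1 := ⟨g.natDegree - 1, by omega⟩
  have hconst : (Fintype.card F * u : ℂ) ^ (g.natDegree - 1) *
      ((∑ γ : Fˣ, dualWeight u (γ : F)) *
        ((1 / (Fintype.card F * u : ℂ)) ^ g.natDegree /
          (1 - Fintype.card F * (1 / (Fintype.card F * u))))) =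
      1 / (1 - Fintype.card F * u) := by
    have h1 : (1 : ℂ) - Fintype.card F * (1 / (Fintype.card F * u)) = (u - 1) / u := by
      field_simp
    rw [sum_dualWeight hu, h1, hd, Nat.add_sub_cancel, div_pow, one_pow, pow_succ]
    field_simp
    ring
  have hsplit : ∑ y, fracChar hg (x * y) * progSeries hg u y =
      ∑ y, fracChar hg (x * y) * monicPart hg u y +
        (if x = 0 then (Fintype.card F : ℂ) ^ g.natDegree else 0) *
          (u ^ g.natDegree / (1 - Fintype.card F * u)) := by
    have h := sum_mulShift x (fracChar_isPrimitive hg hgdeg)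
    simp only [progSeries, mul_add, Finset.sum_add_distrib, ← Finset.sum_mul]
    simp_rw [mul_comm x]
    rw [h, card_adjoinRoot hg]
    push_cast
    rfl
  rw [hsplit]
  simp only [progSeries, mul_add, Finset.sum_add_distrib, ← Finset.sum_mul]
  rw [hconst]
  by_cases hx : x = 0
  · subst hx
    have h0 : ∀ v : ℂ, monicPart hg v (0 : AdjoinRoot g) = 0 := fun v => by
      simp [monicPart]
    rw [sum_fracChar_mul_monicPart_zero hg hgdeg, geom_sum_eq hqu]
    simp only [smul_zero, h0, mul_zero, Finset.sum_const_zero, zero_add, if_true]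
    rw [mul_pow]
    field_simp
    ring
  · have hlt := natDegree_modByMonicHom_lt hg hgdeg x
    set k := (AdjoinRoot.modByMonicHom hg x).natDegree with hk
    rw [sum_fracChar_mul_monicPart_of_ne_zero hg hgdeg u hx (k := g.natDegree - 1 - k)
      (by omega), sum_dualWeight_mul_monicPart hg u _ hx, if_neg hx, geom_sum_eq hqu, ← hk]
    have hpow : (Fintype.card F * u : ℂ) ^ (g.natDegree - 1) =
        (Fintype.card F * u : ℂ) ^ (g.natDegree - 1 - k) * (Fintype.card F * u : ℂ) ^ k := by
      rw [← pow_add]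
      congr 1
      omega
    rw [hpow, dualWeight, one_div_pow]
    generalize (Fintype.card F * u : ℂ) ^ (g.natDegree - 1 - k) = A
    have hB : (Fintype.card F * u : ℂ) ^ k ≠ 0 := pow_ne_zero _ (mul_ne_zero hq hu0)
    generalize (Fintype.card F * u : ℂ) ^ k = B at *
    generalize eAddChar F (AdjoinRoot.modByMonicHom hg x).leadingCoeff = E
    field_simp
    ring

/-- Fourier inversion of the functional equation of the progression series. -/
theorem card_mul_progSeries (hg : g.Monic) (hgdeg : 1 ≤ g.natDegree)
    [Fintype (AdjoinRoot g)] {u : ℂ} (hu0 : u ≠ 0) (hu1 : u ≠ 1)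
    (hu : 1 - (Fintype.card F : ℂ) * u ≠ 0) (w : AdjoinRoot g) :
    Fintype.card F * progSeries hg u w =
      u ^ (g.natDegree - 1) * ∑ γ : Fˣ, dualWeight u (γ : F) *
        ∑ y, fracChar hg (-((γ : F) • w) * y) *
          progSeries hg (1 / (Fintype.card F * u)) y := by
  have hq : (Fintype.card F : ℂ) ≠ 0 := Nat.cast_ne_zero.2 Fintype.card_ne_zero
  have hinv : ∑ x, fracChar hg (x * -w) * ∑ y, fracChar hg (x * y) * progSeries hg u y =
      (Fintype.card F : ℂ) ^ g.natDegree * progSeries hg u w := by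
    calc _ = ∑ y, (∑ x, fracChar hg (x * (y - w))) * progSeries hg u y := by
          simp only [Finset.mul_sum, Finset.sum_mul]
          rw [Finset.sum_comm]
          refine Finset.sum_congr rfl fun y _ => Finset.sum_congr rfl fun x _ => ?_
          rw [← mul_assoc, ← AddChar.map_add_eq_mul]
          congr 2
          ring
      _ = ∑ y, (if y = w then (Fintype.card F : ℂ) ^ g.natDegree else 0) * progSeries hg u y := by
          refine Finset.sum_congr rfl fun y _ => ?_
          rw [sum_mulShift _ (fracChar_isPrimitive hg hgdeg), card_adjoinRoot hg]
          simp [sub_eq_zero]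
      _ = _ := by simp
  have hdual : ∑ x, fracChar hg (x * -w) * ∑ y, fracChar hg (x * y) * progSeries hg u y =
      (Fintype.card F * u : ℂ) ^ (g.natDegree - 1) * ∑ γ : Fˣ, dualWeight u (γ : F) *
        ∑ y, fracChar hg (-((γ : F) • w) * y) *
          progSeries hg (1 / (Fintype.card F * u)) y := by
    simp only [sum_fracChar_mul_progSeries hg hgdeg hu0 hu1 hu, Finset.mul_sum]
    rw [Finset.sum_comm]
    refine Finset.sum_congr rfl fun γ _ => ?_
    refine Fintype.sum_equiv (MulAction.toPerm γ⁻¹) _ _ fun x => ?_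
    have h : -((γ : F) • w) * (γ⁻¹ • x) = x * -w := by
      rw [← smul_neg, Units.smul_def γ⁻¹, smul_mul_smul_comm, ← Units.val_mul, mul_inv_cancel,
        Units.val_one, one_smul, mul_comm]
    rw [MulAction.toPerm_apply, h, Units.smul_def]
    ring
  have hd : (Fintype.card F : ℂ) ^ g.natDegree =
      (Fintype.card F : ℂ) ^ (g.natDegree - 1) * Fintype.card F := by
    rw [← pow_succ, Nat.sub_add_cancel hgdeg]
  apply mul_left_cancel₀ (pow_ne_zero (g.natDegree - 1) hq)
  rw [← mul_assoc, ← hd, ← hinv, hdual, mul_pow, mul_assoc]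

/-- The twisted divisor series `R_2(u; χ, a/g)` as a finite sum over residues modulo `g`. -/
noncomputable def residueSeries (hg : g.Monic) [Fintype (AdjoinRoot g)] (χ : AdjoinRoot g →* ℂ)
    (u : ℂ) (a : AdjoinRoot g) : ℂ :=
  ∑ x, ∑ y, χ x * fracChar hg (a * x * y) * (progSeries hg u x * progSeries hg u y)

theorem residueSeries_eq_sum_dual (hg : g.Monic) (hgdeg : 1 ≤ g.natDegree)
    [Fintype (AdjoinRoot g)] (χ : AdjoinRoot g →* ℂ) {u : ℂ} (hu0 : u ≠ 0) (hu1 : u ≠ 1)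
    (hu : 1 - (Fintype.card F : ℂ) * u ≠ 0) {c b : AdjoinRoot g} (hcb : c * b = 1) :
    residueSeries hg χ u c = (Fintype.card F * u : ℂ) ^ (g.natDegree - 1) *
      ∑ γ : Fˣ, dualWeight u (γ : F) * ∑ z, χ ((γ : F) • (b * z)) *
        progSeries hg u ((γ : F) • (b * z)) * progSeries hg (1 / (Fintype.card F * u)) z := by
  calc residueSeries hg χ u c
      = ∑ x, χ x * progSeries hg u x * ∑ y, fracChar hg (c * x * y) * progSeries hg u y := by
        simp only [residueSeries, Finset.mul_sum]
        refine Finset.sum_congr rfl fun x _ => Finset.sum_congr rfl fun y _ => ?_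
        ring
    _ = (Fintype.card F * u : ℂ) ^ (g.natDegree - 1) * ∑ γ : Fˣ, dualWeight u (γ : F) *
          ∑ x, χ x * progSeries hg u x *
            progSeries hg (1 / (Fintype.card F * u)) (((γ⁻¹ : Fˣ) : F) • (c * x)) := by
        simp only [sum_fracChar_mul_progSeries hg hgdeg hu0 hu1 hu, Finset.mul_sum]
        rw [Finset.sum_comm]
        refine Finset.sum_congr rfl fun γ _ => Finset.sum_congr rfl fun x _ => ?_
        ring
    _ = _ := by
        congr 1
        refine Finset.sum_congr rfl fun γ _ => ?_
        congr 1
        let e : AdjoinRoot g ≃ AdjoinRoot g :=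
          (Units.mulLeft ⟨c, b, hcb, (mul_comm b c).trans hcb⟩).trans (MulAction.toPerm γ⁻¹)
        refine Fintype.sum_equiv e _ _ fun x => ?_
        have he : e x = ((γ⁻¹ : Fˣ) : F) • (c * x) := rfl
        have he' : (γ : F) • (b * e x) = x := by
          rw [he, mul_smul_comm, smul_smul, ← Units.val_mul, mul_inv_cancel, Units.val_one,
            one_smul, ← mul_assoc, mul_comm b c, hcb, one_mul]
        rw [he', he]

/-- The weights of the functional equation, as a multiplicative convolution. -/
noncomputable def convWeight (χ : AdjoinRoot g →* ℂ) (u : ℂ) (κ : F) : ℂ :=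
  ∑ γ : Fˣ, χ (algebraMap F (AdjoinRoot g) γ) *
    (dualWeight u (-(γ : F)) * dualWeight u (κ * ((γ⁻¹ : Fˣ) : F)))

theorem card_mul_residueSeries (hg : g.Monic) (hgdeg : 1 ≤ g.natDegree)
    [Fintype (AdjoinRoot g)] (χ : AdjoinRoot g →* ℂ) {u : ℂ} (hu0 : u ≠ 0) (hu1 : u ≠ 1)
    (hu : 1 - (Fintype.card F : ℂ) * u ≠ 0) {c b : AdjoinRoot g} (hcb : c * b = 1) :
    Fintype.card F * residueSeries hg χ u c =
      χ (-b) * (Fintype.card F * u ^ 2) ^ (g.natDegree - 1) *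
        ∑ κ : Fˣ, convWeight χ u (κ : F) *
          residueSeries hg χ (1 / (Fintype.card F * u)) ((κ : F) • b) := by
  set v : ℂ := 1 / (Fintype.card F * u) with hv
  have hχ : ∀ (γ : Fˣ) (z : AdjoinRoot g),
      χ ((γ : F) • (b * z)) = χ (algebraMap F (AdjoinRoot g) γ) * χ b * χ z := by
    intro γ z
    rw [Algebra.smul_def, map_mul, map_mul, mul_assoc]
  have hinner : ∀ γ : Fˣ, Fintype.card F * ∑ z, χ ((γ : F) • (b * z)) *
        progSeries hg u ((γ : F) • (b * z)) * progSeries hg v z =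
      u ^ (g.natDegree - 1) * χ b * χ (algebraMap F (AdjoinRoot g) γ) *
        ∑ κ : Fˣ, dualWeight u ((-κ * γ⁻¹ : Fˣ) : F) * residueSeries hg χ v ((κ : F) • b) := by
    intro γ
    calc _ = u ^ (g.natDegree - 1) * χ b * χ (algebraMap F (AdjoinRoot g) γ) *
        ∑ μ : Fˣ, dualWeight u (μ : F) *
          residueSeries hg χ v (((-(μ * γ) : Fˣ) : F) • b) := by
          rw [Finset.mul_sum]
          have hz : ∀ z, (Fintype.card F : ℂ) * (χ ((γ : F) • (b * z)) *
                progSeries hg u ((γ : F) • (b * z)) * progSeries hg v z) =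
              χ (algebraMap F (AdjoinRoot g) γ) * χ b * χ z * progSeries hg v z *
                (Fintype.card F * progSeries hg u ((γ : F) • (b * z))) := by
            intro z
            rw [hχ]
            ring
          simp only [hz, card_mul_progSeries hg hgdeg hu0 hu1 hu, residueSeries, Finset.mul_sum]
          rw [Finset.sum_comm]
          refine Finset.sum_congr rfl fun μ _ => Finset.sum_congr rfl fun z _ =>
            Finset.sum_congr rfl fun y _ => ?_
          have h : -((μ : F) • (γ : F) • (b * z)) * y =
              ((-(μ * γ) : Fˣ) : F) • b * z * y := by
            rw [Units.val_neg, Units.val_mul, neg_smul, smul_smul, neg_mul, neg_mul, neg_mul,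
              smul_mul_assoc, smul_mul_assoc, smul_mul_assoc]
          rw [h, ← hv]
          ring
      _ = _ := by
          congr 1
          refine Fintype.sum_equiv ((Equiv.mulRight γ).trans (Equiv.neg Fˣ)) _ _ fun μ => ?_
          simp only [Equiv.trans_apply, Equiv.coe_mulRight, Equiv.neg_apply, neg_neg,
            mul_inv_cancel_right]
  rw [residueSeries_eq_sum_dual hg hgdeg χ hu0 hu1 hu hcb, ← hv]
  calc _ = (Fintype.card F * u : ℂ) ^ (g.natDegree - 1) * ∑ γ : Fˣ, dualWeight u (γ : F) *
        (Fintype.card F * ∑ z, χ ((γ : F) • (b * z)) *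
          progSeries hg u ((γ : F) • (b * z)) * progSeries hg v z) := by
        simp only [Finset.mul_sum]
        refine Finset.sum_congr rfl fun γ _ => Finset.sum_congr rfl fun z _ => ?_
        ring
    _ = (Fintype.card F * u : ℂ) ^ (g.natDegree - 1) * ∑ γ : Fˣ, dualWeight u ((-γ : Fˣ) : F) *
        (u ^ (g.natDegree - 1) * χ b * χ (algebraMap F (AdjoinRoot g) ((-γ : Fˣ) : F)) *
        ∑ κ : Fˣ, dualWeight u ((-κ * (-γ)⁻¹ : Fˣ) : F) *
          residueSeries hg χ v ((κ : F) • b)) := by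
        simp only [hinner]
        congr 1
        exact (Fintype.sum_equiv (Equiv.neg Fˣ) _ _ fun _ => rfl).symm
    _ = _ := by
        simp only [convWeight, Finset.mul_sum, Finset.sum_mul]
        rw [Finset.sum_comm]
        refine Finset.sum_congr rfl fun κ _ => Finset.sum_congr rfl fun γ _ => ?_
        have h1 : χ (algebraMap F (AdjoinRoot g) ((-γ : Fˣ) : F)) * χ b =
            χ (-b) * χ (algebraMap F (AdjoinRoot g) γ) := by
          rw [← map_mul, ← map_mul, Units.val_neg, map_neg, neg_mul, neg_mul, mul_comm]
        have h2 : ((-κ * (-γ)⁻¹ : Fˣ) : F) = κ * ((γ⁻¹ : Fˣ) : F) := by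
          simp [inv_neg]
        have h3 : (Fintype.card F * u ^ 2 : ℂ) ^ (g.natDegree - 1) =
            (Fintype.card F * u : ℂ) ^ (g.natDegree - 1) * u ^ (g.natDegree - 1) := by
          rw [← mul_pow]
          congr 1
          ring
        rw [h2, h3, Units.val_neg]
        rw [Units.val_neg] at h1
        linear_combination (Fintype.card F * u : ℂ) ^ (g.natDegree - 1) *
          dualWeight u (-(γ : F)) * u ^ (g.natDegree - 1) *
          dualWeight u (κ * ((γ⁻¹ : Fˣ) : F)) * residueSeries hg χ v ((κ : F) • b) * h1

theorem map_inv_eq_conj {G : Type*} [Group G] [Finite G] (f : G →* ℂ) (x : G) :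
    f x⁻¹ = starRingEnd ℂ (f x) := by
  have hpow : f x ^ Nat.card G = 1 := by rw [← map_pow, pow_card_eq_one', map_one]
  have hnorm : ‖f x‖ = 1 := Complex.norm_eq_one_of_pow_eq_one hpow Nat.card_pos.ne'
  rw [← Complex.inv_eq_conj hnorm]
  exact eq_inv_of_mul_eq_one_left (by rw [← map_mul, inv_mul_cancel, map_one])

theorem convWeight_eq_card_mul_BCoef {χ : F[X] → ℂ} {ψ : AdjoinRoot g →* ℂ}
    (hψ : ∀ f, ψ (AdjoinRoot.mk g f) = χ f) {u : ℂ}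
    (hu : 1 - (Fintype.card F : ℂ) * u ≠ 0) (κ : F) :
    convWeight ψ u κ = Fintype.card F * BCoef χ κ u := by
  have hq : (Fintype.card F : ℂ) ≠ 0 := Nat.cast_ne_zero.2 Fintype.card_ne_zero
  let η : Fˣ →* ℂ :=
    ψ.comp ((algebraMap F (AdjoinRoot g)).toMonoidHom.comp (Units.coeHom F))
  have hη : ∀ γ : Fˣ, χ (C (γ : F)) = η γ := fun γ => (hψ _).symm
  have heven : ∑ γ : Fˣ, η γ = ((Fintype.card F : ℂ) - 1) *
      (if ∀ γ : Fˣ, χ (C (γ : F)) = 1 then 1 else 0) := by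
    rw [sum_hom_units]
    have hiff : (∀ γ : Fˣ, χ (C (γ : F)) = 1) ↔ η = 1 := by
      simp only [hη, MonoidHom.ext_iff, MonoidHom.one_apply]
    simp only [hiff]
    rw [Fintype.card_units]
    split_ifs
    · rw [Nat.cast_sub Fintype.card_pos, Nat.cast_one, mul_one]
    · rw [Nat.cast_zero, mul_zero]
  have hconj : tauChi (conjChar χ) κ = ∑ γ : Fˣ, η γ * eAddChar F (κ * ((γ⁻¹ : Fˣ) : F)) := by
    refine Fintype.sum_equiv (Equiv.inv Fˣ) _ _ fun γ => ?_
    rw [conjChar, hη, Equiv.inv_apply, map_inv_eq_conj, inv_inv, eAddChar_apply]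
  rw [BCoef, hconj, KlChi, tauChi]
  have hmul : ∀ A B D : ℂ, (Fintype.card F : ℂ) * (A / Fintype.card F -
      B / (Fintype.card F * (1 - Fintype.card F * u)) +
      ((Fintype.card F : ℂ) - 1) / (Fintype.card F * (1 - Fintype.card F * u) ^ 2) * D) =
      A - B * (1 / (1 - Fintype.card F * u)) +
        (((Fintype.card F : ℂ) - 1) * D) * (1 / (1 - Fintype.card F * u)) ^ 2 := by
    intro A B D
    field_simp
  rw [hmul, ← heven, convWeight, ← Finset.sum_add_distrib, Finset.sum_mul, Finset.sum_mul,
    ← Finset.sum_sub_distrib, ← Finset.sum_add_distrib]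
  refine Finset.sum_congr rfl fun γ _ => ?_
  have h : ψ (algebraMap F (AdjoinRoot g) γ) = η γ := rfl
  rw [h, hη, dualWeight, dualWeight, ← eAddChar_apply, ← eAddChar_apply, AddChar.map_add_eq_mul,
    neg_one_mul]
  ring

theorem residueSeries_functional_equation (hg : g.Monic) (hgdeg : 1 ≤ g.natDegree)
    [Fintype (AdjoinRoot g)] {χ : F[X] → ℂ} {ψ : AdjoinRoot g →* ℂ}
    (hψ : ∀ f, ψ (AdjoinRoot.mk g f) = χ f) {u : ℂ} (hu0 : u ≠ 0) (hu1 : u ≠ 1)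
    (hu : 1 - (Fintype.card F : ℂ) * u ≠ 0) {c b : F[X]} (hcb : g ∣ c * b - 1) :
    residueSeries hg ψ u (AdjoinRoot.mk g c) =
      conjChar χ (-c) * (Fintype.card F * u ^ 2) ^ (g.natDegree - 1) *
        ∑ κ : Fˣ, BCoef χ (κ : F) u *
          residueSeries hg ψ (1 / (Fintype.card F * u)) (AdjoinRoot.mk g (C (κ : F) * b)) := by
  have hq : (Fintype.card F : ℂ) ≠ 0 := Nat.cast_ne_zero.2 Fintype.card_ne_zero
  have hcb' : AdjoinRoot.mk g c * AdjoinRoot.mk g b = 1 := by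
    rw [← map_mul, ← map_one (AdjoinRoot.mk g), AdjoinRoot.mk_eq_mk]
    exact hcb
  have hconj : ψ (-AdjoinRoot.mk g b) = conjChar χ (-c) := by
    let y : (AdjoinRoot g)ˣ := ⟨-AdjoinRoot.mk g c, -AdjoinRoot.mk g b,
      by rw [neg_mul_neg, hcb'], by rw [neg_mul_neg, mul_comm, hcb']⟩
    have h := map_inv_eq_conj (ψ.comp (Units.coeHom (AdjoinRoot g))) y
    rw [conjChar, ← hψ, map_neg (AdjoinRoot.mk g)]
    exact h
  apply mul_left_cancel₀ hq
  rw [card_mul_residueSeries hg hgdeg ψ hu0 hu1 hu hcb', hconj, Finset.mul_sum, Finset.mul_sum,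
    Finset.mul_sum]
  refine Finset.sum_congr rfl fun κ _ => ?_
  have h : AdjoinRoot.mk g (C (κ : F) * b) = (κ : F) • AdjoinRoot.mk g b := by
    rw [← smul_eq_C_mul, AdjoinRoot.smul_mk]
  rw [h, convWeight_eq_card_mul_BCoef hψ hu]
  ring

/-- Monic polynomials, sorted by degree. -/
noncomputable def sigmaDegreeLTEquivMonic (F : Type) [Field F] :
    (Σ n, degreeLT F n) ≃ {f : F[X] // f.Monic} :=
  (Equiv.sigmaCongrRight fun n => ((Equiv.subtypeSubtypeEquivSubtypeInter Monic
    (fun f : F[X] => f.natDegree = n)).trans (monicEquivDegreeLT n)).symm).trans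
      (Equiv.sigmaFiberEquiv fun f : {f : F[X] // f.Monic} => (f : F[X]).natDegree)

theorem natDegree_sigmaDegreeLTEquivMonic {F : Type} [Field F] (s : Σ n, degreeLT F n) :
    (sigmaDegreeLTEquivMonic F s : F[X]).natDegree = s.1 :=
  ((monicEquivDegreeLT s.1).symm s.2).2.2

theorem norm_card_mul_lt_one {u : ℂ} (hu : ‖u‖ < 1 / (Fintype.card F : ℝ)) :
    ‖(Fintype.card F : ℂ) * u‖ < 1 := by
  rw [norm_mul, Complex.norm_natCast, mul_comm]
  exact (lt_div_iff₀ (by exact_mod_cast Fintype.card_pos)).1 hu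

theorem sub_ne_zero_of_norm_card_mul_lt {u : ℂ} (hu : ‖u‖ < 1 / (Fintype.card F : ℝ)) :
    1 - (Fintype.card F : ℂ) * u ≠ 0 := by
  intro h
  have hlt := norm_card_mul_lt_one hu
  rw [← sub_eq_zero.1 h, norm_one] at hlt
  exact lt_irrefl _ hlt

theorem hasSum_monic {u : ℂ} (hu : ‖u‖ < 1 / (Fintype.card F : ℝ)) :
    HasSum (fun f : {f : F[X] // f.Monic} => u ^ (f : F[X]).natDegree)
      (1 / (1 - Fintype.card F * u)) := by
  have hlt := norm_card_mul_lt_one hu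
  have hconst : ∀ (n : ℕ) (a : ℂ), HasSum (fun _ : degreeLT F n => a)
      ((Fintype.card F : ℂ) ^ n * a) := by
    intro n a
    have h := hasSum_fintype (fun _ : degreeLT F n => a)
    rwa [Finset.sum_const, Finset.card_univ, card_degreeLT, nsmul_eq_mul, Nat.cast_pow] at h
  have hsummable : Summable fun s : Σ n, degreeLT F n => u ^ s.1 := by
    apply Summable.of_norm
    rw [summable_sigma_of_nonneg fun _ => norm_nonneg _]
    refine ⟨fun n => (hasSum_fintype _).summable, ?_⟩
    refine (summable_geometric_of_lt_one (norm_nonneg _) hlt).congr fun n => ?_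
    simp [tsum_fintype, card_degreeLT, mul_pow]
  rw [← (sigmaDegreeLTEquivMonic F).hasSum_iff]
  simp only [Function.comp_def, natDegree_sigmaDegreeLTEquivMonic]
  have hgeom := hasSum_geometric_of_norm_lt_one hlt
  simp only [mul_pow, ← one_div] at hgeom
  exact hgeom.sigma_of_hasSum (fun n => hconst n _) hsummable

theorem natDegree_add_mul_of_degree_lt {F : Type} [Field F] {g : F[X]} (hg : g.Monic) {r h : F[X]} (hr : r.degree < g.degree)
    (hh : h ≠ 0) :
    (r + g * h).natDegree = g.natDegree + h.natDegree ∧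
      (r + g * h).leadingCoeff = h.leadingCoeff := by
  have hlt : r.degree < (g * h).degree :=
    hr.trans_le (degree_le_mul_left _ hh)
  rw [natDegree_add_eq_right_of_degree_lt hlt, leadingCoeff_add_of_degree_lt hlt,
    leadingCoeff_mul, hg.leadingCoeff, one_mul, natDegree_mul hg.ne_zero hh]
  exact ⟨rfl, rfl⟩

theorem hasSum_progSeries (hg : g.Monic) {u : ℂ} (hu : ‖u‖ < 1 / (Fintype.card F : ℝ))
    (x : AdjoinRoot g) :
    HasSum (fun f : {f : F[X] // f.Monic} =>
      if AdjoinRoot.mk g (f : F[X]) = x then u ^ (f : F[X]).natDegree else 0)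
      (progSeries hg u x) := by
  set r := AdjoinRoot.modByMonicHom hg x with hr
  have hrdeg : r.degree < g.degree := degree_modByMonicHom_lt hg x
  let j : {f : F[X] // f.Monic} → {f : F[X] // f.Monic} := fun h => ⟨r + g * h, by
    rw [Monic, (natDegree_add_mul_of_degree_lt hg hrdeg h.2.ne_zero).2]
    exact h.2⟩
  have hj : Function.Injective j := by
    intro h h' he
    exact Subtype.ext (mul_left_cancel₀ hg.ne_zero (add_left_cancel (congrArg Subtype.val he)))
  have hjdeg : ∀ h, (j h : F[X]).natDegree = g.natDegree + (h : F[X]).natDegree := fun h =>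
    (natDegree_add_mul_of_degree_lt hg hrdeg h.2.ne_zero).1
  have hsmall : HasSum (fun f : {f : F[X] // f.Monic} =>
      if (f : F[X]) = r then u ^ (f : F[X]).natDegree else 0) (monicPart hg u x) := by
    by_cases hmon : r.Monic
    · rw [monicPart, if_pos hmon]
      refine (hasSum_ite_eq (⟨r, hmon⟩ : {f : F[X] // f.Monic}) (u ^ r.natDegree)).congr_fun fun f => ?_
      by_cases hf : (f : F[X]) = r
      · rw [if_pos hf, if_pos (Subtype.ext hf), hf]
      · rw [if_neg hf, if_neg fun h => hf (congrArg Subtype.val h)]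
    · rw [monicPart, if_neg hmon]
      refine hasSum_zero.congr_fun fun f => if_neg fun hf => hmon ?_
      rw [← hf]
      exact f.2
  have hlarge : HasSum (fun f : {f : F[X] // f.Monic} =>
      if f ∈ Set.range j then u ^ (f : F[X]).natDegree else 0)
      (u ^ g.natDegree / (1 - Fintype.card F * u)) := by
    rw [← hj.hasSum_iff (fun f hf => if_neg hf)]
    simp only [Function.comp_def, Set.mem_range_self, if_true, hjdeg, pow_add]
    rw [div_eq_mul_one_div]
    exact (hasSum_monic hu).mul_left _
  refine (hsmall.add hlarge).congr_fun fun f => ?_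
  have hmk : AdjoinRoot.mk g (f : F[X]) = x ↔ g ∣ (f : F[X]) - r := by
    rw [← AdjoinRoot.mk_eq_mk, hr, mk_modByMonicHom]
  have hdisj : (f : F[X]) = r → f ∉ Set.range j := by
    rintro hf ⟨h, rfl⟩
    have h0 : g * (h : F[X]) = 0 := left_eq_add.1 hf.symm
    exact mul_ne_zero hg.ne_zero h.2.ne_zero h0
  by_cases hf : (f : F[X]) = r
  · rw [if_pos hf, if_neg (hdisj hf), add_zero, if_pos (hmk.2 (by rw [hf, sub_self]; exact dvd_zero g))]
  · rw [if_neg hf, zero_add]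
    congr 1
    rw [hmk]
    refine propext ⟨?_, ?_⟩
    · rintro ⟨h, hh⟩
      have hf' : (f : F[X]) = r + g * h := by rw [← hh, add_sub_cancel]
      have hh0 : h ≠ 0 := by
        rintro rfl
        exact hf (by rw [hf', mul_zero, add_zero])
      refine ⟨⟨h, ?_⟩, Subtype.ext hf'.symm⟩
      rw [Monic, ← (natDegree_add_mul_of_degree_lt hg hrdeg hh0).2, ← hf']
      exact f.2
    · rintro ⟨h, rfl⟩
      exact ⟨h, add_sub_cancel_left _ _⟩

theorem hasSum_mul_prod {ι κ : Type*} {a : ι → ℂ} {b : κ → ℂ} {s t : ℂ}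
    (ha : HasSum a s) (hb : HasSum b t) : HasSum (fun p : ι × κ => a p.1 * b p.2) (s * t) :=
  ha.mul hb (summable_mul_of_summable_norm ha.summable.norm hb.summable.norm)

theorem hasSum_monic_pairs (hg : g.Monic) [Fintype (AdjoinRoot g)] {χ : F[X] → ℂ}
    {ψ : AdjoinRoot g →* ℂ} (hψ : ∀ f, ψ (AdjoinRoot.mk g f) = χ f) (c : F[X]) {u : ℂ}
    (hu : ‖u‖ < 1 / (Fintype.card F : ℝ)) :
    HasSum (fun p : {f : F[X] // f.Monic} × {f : F[X] // f.Monic} =>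
      χ p.1 * eFrac (c * ((p.1 : F[X]) * (p.2 : F[X]))) g * u ^ ((p.1 : F[X]) * p.2).natDegree)
      (residueSeries hg ψ u (AdjoinRoot.mk g c)) := by
  have h : ∀ x y : AdjoinRoot g, HasSum
      (fun p : {f : F[X] // f.Monic} × {f : F[X] // f.Monic} =>
        (if AdjoinRoot.mk g (p.1 : F[X]) = x then u ^ (p.1 : F[X]).natDegree else 0) *
          (if AdjoinRoot.mk g (p.2 : F[X]) = y then u ^ (p.2 : F[X]).natDegree else 0))
      (progSeries hg u x * progSeries hg u y) := by
    intro x y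
    convert hasSum_mul_prod (hasSum_progSeries hg hu x) (hasSum_progSeries hg hu y)
  refine (hasSum_sum fun x _ => hasSum_sum fun y _ =>
    (h x y).mul_left (ψ x * fracChar hg (AdjoinRoot.mk g c * x * y))).congr_fun fun p => ?_
  rw [Finset.sum_eq_single (AdjoinRoot.mk g (p.1 : F[X])),
    Finset.sum_eq_single (AdjoinRoot.mk g (p.2 : F[X]))]
  · rw [if_pos rfl, if_pos rfl, hψ, ← map_mul, ← map_mul, fracChar_mk, ← pow_add,
      natDegree_mul p.1.2.ne_zero p.2.2.ne_zero, mul_assoc c]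
  · intro y _ hy
    rw [if_neg hy.symm, mul_zero, mul_zero]
  · simp
  · intro x _ hx
    simp [if_neg hx.symm]
  · simp

theorem finite_monic_dvd {f : F[X]} (hf : f.Monic) :
    {a : F[X] | a.Monic ∧ a ∣ f}.Finite := by
  have hfin : (degreeLT F (f.natDegree + 1) : Set F[X]).Finite :=
    Set.finite_coe_iff.1 (inferInstanceAs (Finite (degreeLT F (f.natDegree + 1))))
  refine hfin.subset fun a ha => ?_
  refine mem_degreeLT.2 ((degree_le_of_dvd ha.2 hf.ne_zero).trans_lt ?_)
  rw [degree_eq_natDegree hf.ne_zero]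
  exact_mod_cast Nat.lt_succ_self _

theorem hasSum_rChi (χ : F[X] → ℂ) (f : {f : F[X] // f.Monic}) :
    HasSum (fun p : {p : {f : F[X] // f.Monic} × {f : F[X] // f.Monic} //
      (⟨p.1 * p.2, p.1.2.mul p.2.2⟩ : {f : F[X] // f.Monic}) = f} => χ p.1.1) (rChi χ f) := by
  let _ : Fintype {a : F[X] | a.Monic ∧ a ∣ (f : F[X])} := (finite_monic_dvd f.2).fintype
  have h := hasSum_fintype fun a : {a : F[X] | a.Monic ∧ a ∣ (f : F[X])} => χ a
  rw [← finsum_eq_sum_of_fintype, finsum_set_coe_eq_finsum_mem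
    (f := χ) {a : F[X] | a.Monic ∧ a ∣ (f : F[X])}] at h
  let e : {p : {f : F[X] // f.Monic} × {f : F[X] // f.Monic} //
      (⟨p.1 * p.2, p.1.2.mul p.2.2⟩ : {f : F[X] // f.Monic}) = f} →
      {a : F[X] | a.Monic ∧ a ∣ (f : F[X])} :=
    fun p => ⟨p.1.1, p.1.1.2, p.1.2, (congrArg Subtype.val p.2).symm⟩
  have he : Function.Bijective e := by
    constructor
    · rintro ⟨⟨a, b⟩, hp⟩ ⟨⟨a', b'⟩, hp'⟩ h
      have ha : a = a' := Subtype.ext (congrArg (fun s : {a : F[X] | a.Monic ∧ a ∣ (f : F[X])} => (s : F[X])) h)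
      subst ha
      have hb : (a : F[X]) * b = a * b' := congrArg Subtype.val (hp.trans hp'.symm)
      have hb' : b = b' := Subtype.ext (mul_left_cancel₀ a.2.ne_zero hb)
      subst hb'
      rfl
    · rintro ⟨a, ha, b, hb⟩
      have hbm : b.Monic := ha.of_mul_monic_left (hb ▸ f.2)
      exact ⟨⟨⟨⟨a, ha⟩, ⟨b, hbm⟩⟩, Subtype.ext hb.symm⟩, rfl⟩
  exact (Equiv.ofBijective e he).hasSum_iff.2 h

theorem hasSum_rChi_mul_eFrac (hg : g.Monic) [Fintype (AdjoinRoot g)] {χ : F[X] → ℂ}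
    {ψ : AdjoinRoot g →* ℂ} (hψ : ∀ f, ψ (AdjoinRoot.mk g f) = χ f) (c : F[X]) {u : ℂ}
    (hu : ‖u‖ < 1 / (Fintype.card F : ℝ)) :
    HasSum (fun f : {f : F[X] // f.Monic} =>
      rChi χ f * eFrac (c * (f : F[X])) g * u ^ (f : F[X]).natDegree)
      (residueSeries hg ψ u (AdjoinRoot.mk g c)) := by
  refine ((Equiv.sigmaFiberEquiv
    (fun p : {f : F[X] // f.Monic} × {f : F[X] // f.Monic} =>
      (⟨p.1 * p.2, p.1.2.mul p.2.2⟩ : {f : F[X] // f.Monic}))).hasSum_iff.2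
      (hasSum_monic_pairs hg hψ c hu)).sigma fun f => ?_
  simp only [mul_assoc (rChi χ f)]
  refine ((hasSum_rChi χ f).mul_right _).congr_fun fun p => ?_
  have hp : (p.1.1 : F[X]) * p.1.2 = f := congrArg Subtype.val p.2
  simp only [Function.comp_apply, Equiv.sigmaFiberEquiv_apply, hp, mul_assoc]

/-- The numerator of the rational function `progSeries`. -/
noncomputable def progNumerator (hg : g.Monic) (x : AdjoinRoot g) : ℂ[X] :=
  (1 - C (Fintype.card F : ℂ) * X) * (if (AdjoinRoot.modByMonicHom hg x).Monic then
    X ^ (AdjoinRoot.modByMonicHom hg x).natDegree else 0) + X ^ g.natDegree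

theorem progSeries_eq_div (hg : g.Monic) (x : AdjoinRoot g) {z : ℂ}
    (hz : 1 - (Fintype.card F : ℂ) * z ≠ 0) :
    progSeries hg z x = (progNumerator hg x).eval z / (1 - Fintype.card F * z) := by
  rw [progSeries, progNumerator, monicPart, eq_div_iff hz, add_mul, div_mul_cancel₀ _ hz]
  split_ifs <;> simp [mul_comm]

theorem exists_numerator_residueSeries (hg : g.Monic) [Fintype (AdjoinRoot g)]
    (ψ : AdjoinRoot g →* ℂ) (a : AdjoinRoot g) :
    ∃ N : ℂ[X], ∀ z : ℂ, 1 - (Fintype.card F : ℂ) * z ≠ 0 →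
      residueSeries hg ψ z a =
        N.eval z / ((1 - C (Fintype.card F : ℂ) * X) ^ 2 : ℂ[X]).eval z := by
  refine ⟨∑ x, ∑ y, C (ψ x * fracChar hg (a * x * y)) *
    (progNumerator hg x * progNumerator hg y), fun z hz => ?_⟩
  simp only [residueSeries, progSeries_eq_div hg _ hz, eval_finsetSum, eval_mul, eval_pow,
    eval_sub, eval_one, eval_C, eval_X, Finset.sum_div]
  refine Finset.sum_congr rfl fun x _ => Finset.sum_congr rfl fun y _ => ?_
  rw [div_mul_div_comm, sq, mul_div_assoc']

theorem IsRatCont.eq_div {a : F[X] → ℂ} {φ : ℂ → ℂ} (hφ : IsRatCont a φ) {N D : ℂ[X]}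
    (hdisc : ∀ z : ℂ, ‖z‖ < 1 / (Fintype.card F : ℝ) →
      D.eval z ≠ 0 ∧ φ z = N.eval z / D.eval z) {v : ℂ} (hv : D.eval v ≠ 0) :
    φ v = N.eval v / D.eval v := by
  obtain ⟨⟨P, Q, hPQ, hQ, heq⟩, -⟩ := hφ
  have hball : (Metric.ball (0 : ℂ) (1 / (Fintype.card F : ℝ))).Infinite :=
    infinite_of_mem_nhds 0 (Metric.ball_mem_nhds 0
      (one_div_pos.2 (by exact_mod_cast Fintype.card_pos)))
  have hroots : {z : ℂ | Q.eval z = 0}.Finite := by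
    refine Q.roots.toFinset.finite_toSet.subset fun z hz => ?_
    simpa [hQ] using hz
  have hpoly : P * D = N * Q := by
    refine eq_of_infinite_eval_eq _ _ ((hball.sdiff hroots).mono ?_)
    rintro z ⟨hz, hzQ⟩
    obtain ⟨hD, hφz⟩ := hdisc z (by simpa using hz)
    have h := (heq z hzQ).symm.trans hφz
    rw [div_eq_div_iff hzQ hD] at h
    simpa using h
  have hQv : Q.eval v ≠ 0 := by
    have hdvd : Q ∣ D := hPQ.symm.dvd_of_dvd_mul_left ⟨N, by rw [hpoly, mul_comm]⟩
    exact fun h => hv (eval_eq_zero_of_dvd_of_eval_eq_zero hdvd h)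
  rw [heq v hQv, div_eq_div_iff hQv hv, ← eval_mul, hpoly, eval_mul]

theorem IsRatCont.eq_residueSeries (hg : g.Monic) [Fintype (AdjoinRoot g)] {χ : F[X] → ℂ}
    {ψ : AdjoinRoot g →* ℂ} (hψ : ∀ f, ψ (AdjoinRoot.mk g f) = χ f) {c : F[X]} {φ : ℂ → ℂ}
    (hφ : IsRatCont (fun f => rChi χ f * eFrac (c * f) g) φ) {v : ℂ}
    (hv : 1 - (Fintype.card F : ℂ) * v ≠ 0) :
    φ v = residueSeries hg ψ v (AdjoinRoot.mk g c) := by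
  obtain ⟨N, hN⟩ := exists_numerator_residueSeries hg ψ (AdjoinRoot.mk g c)
  have hD : ∀ z : ℂ, 1 - (Fintype.card F : ℂ) * z ≠ 0 →
      ((1 - C (Fintype.card F : ℂ) * X) ^ 2 : ℂ[X]).eval z ≠ 0 := by
    intro z hz
    simpa using hz
  rw [hN v hv]
  refine hφ.eq_div (fun z hz => ?_) (hD v hv)
  have hz' := sub_ne_zero_of_norm_card_mul_lt hz
  exact ⟨hD z hz', ((hφ.2 z hz).unique (hasSum_rChi_mul_eFrac hg hψ c hz)).trans (hN z hz')⟩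

/-- A Dirichlet character modulo a divisor of `g`, viewed on residues modulo `g`. -/
noncomputable def IsDirichletChar.toResidueHom {ℓ : F[X]} {χ : F[X] → ℂ}
    (hχ : IsDirichletChar ℓ χ) (hg : g.Monic) (hdvd : ℓ ∣ g) : AdjoinRoot g →* ℂ where
  toFun x := χ (AdjoinRoot.modByMonicHom hg x)
  map_one' := by
    rw [← hχ.2.2.1]
    refine hχ.1 _ _ (mod_eq_of_dvd_sub (hdvd.trans ?_))
    rw [← AdjoinRoot.mk_eq_mk, mk_modByMonicHom, map_one]
  map_mul' x y := by
    rw [← hχ.2.1]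
    refine hχ.1 _ _ (mod_eq_of_dvd_sub (hdvd.trans ?_))
    rw [← AdjoinRoot.mk_eq_mk, mk_modByMonicHom, map_mul (AdjoinRoot.mk g), mk_modByMonicHom,
      mk_modByMonicHom]

theorem IsDirichletChar.toResidueHom_mk {F : Type} [Field F] {g ℓ : F[X]} {χ : F[X] → ℂ}
    (hχ : IsDirichletChar ℓ χ) (hg : g.Monic) (hdvd : ℓ ∣ g) (f : F[X]) :
    hχ.toResidueHom hg hdvd (AdjoinRoot.mk g f) = χ f := by
  refine hχ.1 _ _ (mod_eq_of_dvd_sub (hdvd.trans ?_))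
  rw [← AdjoinRoot.mk_eq_mk, mk_modByMonicHom]

end TwistedFunctionalEquation

/-- **Functional equation of `R_2(u;χ,c/g)` in the dividing-modulus case `ℓ ∣ g`:**
for `0 < |u| < 1/q`,
`R_2(u;χ,c/g) = χ̄(-c)(qu²)^{deg g - 1} Σ_λ B_λ(u;χ)·R_2(1/(qu);χ,λc̄/g)`,
with `R_2` on the right evaluated via its rational continuation. -/
theorem twistedR2_functional_equation_dividing
    (F : Type) [Field F] [Fintype F] (q : ℕ) (hq : q = Fintype.card F)
    (g ℓ : Polynomial F) (hg : g.Monic) (hgdeg : 1 ≤ g.natDegree) (hℓ : ℓ.Monic)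
    (hdvd : ℓ ∣ g)
    (c cbar : Polynomial F) (hcop : IsCoprime c g) (hcbar : g ∣ c * cbar - 1)
    (χ : Polynomial F → ℂ) (hχ : IsPrimitiveChar ℓ χ)
    (φ : Fˣ → ℂ → ℂ)
    (hφ : ∀ lam : Fˣ,
      IsRatCont
        (fun f => rChi χ f * eFrac (Polynomial.C (lam : F) * cbar * f) g)
        (φ lam))
    (u : ℂ) (hu0 : 0 < ‖u‖) (hu : ‖u‖ < 1 / q) :
    monicSeries (fun f => rChi χ f * eFrac (c * f) g) u =
      conjChar χ (-c) * ((q : ℂ) * u ^ 2) ^ ((g.natDegree : ℤ) - 1) *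
        ∑ lam : Fˣ, BCoef χ (lam : F) u * φ lam (1 / ((q : ℂ) * u)) := by
  subst hq
  let _ := adjoinRootFintype hg
  have hu0' : u ≠ 0 := norm_pos_iff.1 hu0
  have hq : (Fintype.card F : ℂ) ≠ 0 := Nat.cast_ne_zero.2 Fintype.card_ne_zero
  have hu1 : u ≠ 1 := by
    rintro rfl
    have hcard : (1 : ℝ) ≤ Fintype.card F := by exact_mod_cast Fintype.card_pos (α := F)
    rw [norm_one, lt_div_iff₀ (one_pos.trans_le hcard), one_mul] at hu
    exact hcard.not_gt hu
  have hψ := hχ.1.toResidueHom_mk hg hdvd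
  have hv : 1 - (Fintype.card F : ℂ) * (1 / (Fintype.card F * u)) ≠ 0 := by
    intro h
    field_simp at h
    rw [mul_zero] at h
    exact hu1 (sub_eq_zero.1 h)
  have hpow : ((Fintype.card F : ℂ) * u ^ 2) ^ ((g.natDegree : ℤ) - 1) =
      ((Fintype.card F : ℂ) * u ^ 2) ^ (g.natDegree - 1) := by
    rw [← Nat.cast_one, ← Nat.cast_sub hgdeg, zpow_natCast]
  rw [monicSeries, (hasSum_rChi_mul_eFrac hg hψ c hu).tsum_eq,
    residueSeries_functional_equation hg hgdeg hψ hu0' hu1 (sub_ne_zero_of_norm_card_mul_lt hu)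
      hcbar, hpow]
  congr 1
  refine Finset.sum_congr rfl fun lam _ => ?_
  rw [(hφ lam).eq_residueSeries hg hψ hv]
end

section
/- (Voronoi summation formula for r_χ, dividing modulus case.) Let n ≥ 0, let g ∈ 𝔽_q[T] be monic of degree ≥ 1, ℓ ∈ 𝔽_q[T] monic with ℓ ≠ 1 and ℓ | g, and c ∈ 𝔽_q[T] with gcd(c,g) = 1; let χ be a primitive Dirichlet character modulo ℓ and c̄ any multiplicative inverse of c modulo g. Set ν := 2·deg g − n − 2. Then Σ_{f ∈ M_n} r_χ(f)·e(cf/g) = (q^n/|g|)·G(χ)·χ̄(c)·L(1,χ̄) + (q^n/|g|)·χ̄(−c) · Σ_{λ ∈ 𝔽_q^×} Σ_{η₁,η₂ ∈ {0,1}} Σ_{0 ≤ k ≤ ν} b_{ν−k}(χ;λ,η₁,η₂) · Σ_{f ∈ M_k} r_χ(f)·e(λc̄f/g), where the second term is 0 when ν < 0. -/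
open Polynomial
open scoped Classical

section AdditiveCharacter

lemma exists_addChar_eq_eChar (F : Type) [Field F] [Fintype F] :
    ∃ ψ : AddChar F ℂ, ψ ≠ 1 ∧ ∀ y, ψ y = eChar F y := by
  let _ : Algebra (ZMod (ringChar F)) F := ZMod.algebra F (ringChar F)
  have : Fact (ringChar F).Prime := ⟨CharP.char_is_prime F (ringChar F)⟩
  have : NeZero (ringChar F) := ⟨(Fact.out : (ringChar F).Prime).ne_zero⟩
  have happly : ∀ y, (ZMod.stdAddChar (N := ringChar F)).compAddMonoidHom
      (Algebra.trace (ZMod (ringChar F)) F).toAddMonoidHom y = eChar F y := by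
    intro y
    simp only [AddChar.compAddMonoidHom_apply, ZMod.stdAddChar_apply, ZMod.toCircle_apply]
    rfl
  refine ⟨_, ?_, happly⟩
  obtain ⟨a, ha⟩ := FiniteField.trace_to_zmod_nondegenerate F (one_ne_zero (α := F))
  rw [one_mul] at ha
  intro h
  apply ha
  have h2 := DFunLike.congr_fun h a
  simp only [AddChar.compAddMonoidHom_apply, AddChar.one_apply] at h2
  rw [← AddChar.map_zero_eq_one (ZMod.stdAddChar (N := ringChar F))] at h2
  exact ZMod.injective_stdAddChar h2

variable {F : Type} [Field F] [Fintype F]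

lemma eChar_add (x y : F) : eChar F (x + y) = eChar F x * eChar F y := by
  obtain ⟨ψ, -, h⟩ := exists_addChar_eq_eChar F
  simp only [← h, AddChar.map_add_eq_mul]

@[simp] lemma eChar_zero : eChar F 0 = 1 := by
  obtain ⟨ψ, -, h⟩ := exists_addChar_eq_eChar F
  simp only [← h, AddChar.map_zero_eq_one]

lemma exists_eChar_ne_one (F : Type) [Field F] [Fintype F] : ∃ x : F, eChar F x ≠ 1 := by
  obtain ⟨ψ, h1, h⟩ := exists_addChar_eq_eChar F
  obtain ⟨x, hx⟩ := AddChar.ne_one_iff.1 h1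
  exact ⟨x, by rwa [← h]⟩

lemma eFrac_add (a b g : F[X]) : eFrac (a + b) g = eFrac a g * eFrac b g := by
  simp only [eFrac, add_mod, coeff_add, eChar_add]

lemma eFrac_congr {a b g : F[X]} (h : g ∣ a - b) : eFrac a g = eFrac b g := by
  rw [eFrac, eFrac, mod_eq_of_dvd_sub h]

lemma eFrac_eq_one_of_dvd {a g : F[X]} (h : g ∣ a) : eFrac a g = 1 := by
  simp [eFrac, EuclideanDomain.mod_eq_zero.2 h]

lemma eFrac_of_degree_lt {a g : F[X]} (h : a.degree < g.degree) :
    eFrac a g = eChar F (a.coeff (g.natDegree - 1)) := by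
  rw [eFrac, (mod_eq_self_iff (by rintro rfl; simp at h)).2 h]

end AdditiveCharacter

section PolynomialSets

variable {F : Type} [Field F] [Fintype F]

lemma finite_degree_lt (F : Type) [Field F] [Fintype F] (m : ℕ) :
    {f : F[X] | f.degree < m}.Finite := by
  have : Finite (degreeLT F m) := Finite.of_equiv _ (degreeLTEquiv F m).symm.toEquiv
  exact (Set.toFinite (degreeLT F m : Set F[X])).subset fun f hf => mem_degreeLT.2 hf

lemma finite_monic_natDegree (F : Type) [Field F] [Fintype F] (m : ℕ) :
    {f : F[X] | f.Monic ∧ f.natDegree = m}.Finite :=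
  (finite_degree_lt F (m + 1)).subset fun f hf => by
    obtain ⟨-, rfl⟩ := hf
    exact degree_le_natDegree.trans_lt (by exact_mod_cast Nat.lt_succ_self _)

/-- The polynomials of degree less than `m`. -/
noncomputable def polysLT (F : Type) [Field F] [Fintype F] (m : ℕ) : Finset F[X] :=
  (finite_degree_lt F m).toFinset

/-- The monic polynomials of degree `m`. -/
noncomputable def monics (F : Type) [Field F] [Fintype F] (m : ℕ) : Finset F[X] :=
  (finite_monic_natDegree F m).toFinset

@[simp] lemma mem_polysLT {m : ℕ} {f : F[X]} : f ∈ polysLT F m ↔ f.degree < m := by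
  simp [polysLT]

@[simp] lemma mem_monics {m : ℕ} {f : F[X]} : f ∈ monics F m ↔ f.Monic ∧ f.natDegree = m := by
  simp [monics]

lemma finsum_monics (m : ℕ) (H : F[X] → ℂ) :
    ∑ᶠ f ∈ {f : F[X] | f.Monic ∧ f.natDegree = m}, H f = ∑ f ∈ monics F m, H f := by
  rw [finsum_mem_eq_finite_toFinset_sum _ (finite_monic_natDegree F m)]
  rfl

lemma card_polysLT (m : ℕ) : (polysLT F m).card = Fintype.card F ^ m := by
  have h : Nat.card (degreeLT F m) = Fintype.card F ^ m := by
    rw [Nat.card_congr (degreeLTEquiv F m).toEquiv]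
    simp
  rw [← h, ← Nat.card_eq_finsetCard]
  exact Nat.card_congr (Equiv.subtypeEquivRight fun f => by rw [mem_polysLT, mem_degreeLT])

lemma sum_monics (m : ℕ) (H : F[X] → ℂ) :
    ∑ f ∈ monics F m, H f = ∑ f ∈ polysLT F m, H (X ^ m + f) := by
  refine Finset.sum_bij' (fun f _ => f - X ^ m) (fun f _ => X ^ m + f) ?_ ?_ ?_ ?_ ?_
  · intro f hf
    obtain ⟨h1, rfl⟩ := mem_monics.1 hf
    rw [mem_polysLT, ← degree_eq_natDegree h1.ne_zero]
    refine degree_sub_lt_left ?_ h1.ne_zero ?_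
    · rw [degree_X_pow, degree_eq_natDegree h1.ne_zero]
    · rw [h1.leadingCoeff, leadingCoeff_X_pow]
  · intro f hf
    rw [mem_polysLT] at hf
    refine mem_monics.2 ⟨monic_X_pow_add hf, ?_⟩
    refine natDegree_eq_of_degree_eq_some ?_
    rw [degree_add_eq_left_of_degree_lt (by rwa [degree_X_pow]), degree_X_pow]
  all_goals intros; simp

lemma sum_polysLT_add (m : ℕ) {t : F[X]} (ht : t.degree < m) (H : F[X] → ℂ) :
    ∑ f ∈ polysLT F m, H (f + t) = ∑ f ∈ polysLT F m, H f := by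
  refine Finset.sum_bij' (fun f _ => f + t) (fun f _ => f - t) ?_ ?_ ?_ ?_ ?_
  · intro f hf
    rw [mem_polysLT] at *
    exact (degree_add_le _ _).trans_lt (max_lt hf ht)
  · intro f hf
    rw [mem_polysLT] at *
    exact (degree_sub_le _ _).trans_lt (max_lt hf ht)
  all_goals intros; simp

lemma sum_polysLT_eq_zero_of_shift (m : ℕ) {t : F[X]} (ht : t.degree < m) (H : F[X] → ℂ)
    {z : ℂ} (hz : z ≠ 1) (h : ∀ f, H (f + t) = z * H f) : ∑ f ∈ polysLT F m, H f = 0 := by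
  have h1 := sum_polysLT_add m ht H
  simp only [h, ← Finset.mul_sum] at h1
  have h2 : (z - 1) * ∑ f ∈ polysLT F m, H f = 0 := by linear_combination h1
  exact (mul_eq_zero.1 h2).resolve_left (sub_ne_zero.2 hz)

/-- A sum over a full range of residues against a twist by the top coefficient vanishes. -/
lemma sum_polysLT_mul_eChar_coeff_eq_zero {w : F[X]} (hw : w.Monic) {m : ℕ}
    (hm : w.natDegree < m) (H : F[X] → ℂ) (hH : ∀ f k, H (f + k * w) = H f) :
    ∑ f ∈ polysLT F m, H f * eChar F (f.coeff (m - 1)) = 0 := by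
  obtain ⟨x, hx⟩ := exists_eChar_ne_one F
  have hdeg : (C x * X ^ (m - 1 - w.natDegree) * w).degree < (m : WithBot ℕ) := by
    refine degree_le_natDegree.trans_lt ?_
    have h1 : (C x * X ^ (m - 1 - w.natDegree)).natDegree ≤ m - 1 - w.natDegree :=
      natDegree_C_mul_X_pow_le _ _
    have h2 := natDegree_mul_le (p := C x * X ^ (m - 1 - w.natDegree)) (q := w)
    exact_mod_cast (by omega)
  have hcoeff : (C x * X ^ (m - 1 - w.natDegree) * w).coeff (m - 1) = x := by
    have : m - 1 = w.natDegree + (m - 1 - w.natDegree) := by omega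
    rw [mul_assoc, coeff_C_mul, this, Nat.add_sub_cancel_left, coeff_X_pow_mul]
    simp [hw]
  refine sum_polysLT_eq_zero_of_shift m hdeg _ hx fun f => ?_
  rw [hH, coeff_add, hcoeff, eChar_add]
  ring

lemma sum_polysLT_eFrac_mul {g u : F[X]} (hg : g.Monic) (hu : u.degree < g.degree) {m : ℕ} :
    ∑ a ∈ polysLT F m, eFrac (u * a) g =
      if u.degree < (g.natDegree - m : ℕ) then (Fintype.card F : ℂ) ^ m else 0 := by
  have hgd := degree_eq_natDegree hg.ne_zero
  split_ifs with h
  · rw [Finset.sum_congr rfl (g := fun _ => (1 : ℂ))]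
    · simp [card_polysLT]
    intro a ha
    rw [mem_polysLT] at ha
    by_cases hu0 : u = 0
    · simp [hu0, eFrac]
    by_cases ha0 : a = 0
    · simp [ha0, eFrac]
    rw [degree_eq_natDegree hu0, Nat.cast_lt] at h
    rw [degree_eq_natDegree ha0, Nat.cast_lt] at ha
    have hn := natDegree_mul_le (p := u) (q := a)
    rw [eFrac_of_degree_lt, coeff_eq_zero_of_natDegree_lt, eChar_zero]
    · omega
    · rw [hgd]
      exact degree_le_natDegree.trans_lt (by exact_mod_cast (by omega))
  · have hu0 : u ≠ 0 := by
      rintro rfl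
      simp at h
    rw [hgd, degree_eq_natDegree hu0, Nat.cast_lt] at hu
    rw [degree_eq_natDegree hu0, Nat.cast_lt] at h
    obtain ⟨x, hx⟩ := exists_eChar_ne_one F
    set t : F[X] := C (x / u.leadingCoeff) * X ^ (g.natDegree - 1 - u.natDegree) with ht
    have htd : t.natDegree ≤ g.natDegree - 1 - u.natDegree := natDegree_C_mul_X_pow_le _ _
    have ht1 : t.degree < m :=
      degree_le_natDegree.trans_lt (by exact_mod_cast (by omega))
    have hval : eFrac (u * t) g = eChar F x := by
      have hn := natDegree_mul_le (p := u) (q := t)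
      rw [eFrac_of_degree_lt]
      · have : g.natDegree - 1 = u.natDegree + (g.natDegree - 1 - u.natDegree) := by omega
        rw [ht, mul_left_comm, coeff_C_mul]
        nth_rewrite 2 [this]
        rw [coeff_mul_X_pow, coeff_natDegree, div_mul_cancel₀ _ (leadingCoeff_ne_zero.2 hu0)]
      · rw [hgd]
        exact degree_le_natDegree.trans_lt (by exact_mod_cast (by omega))
    refine sum_polysLT_eq_zero_of_shift m ht1 _ hx fun f => ?_
    rw [mul_add, eFrac_add, hval, mul_comm]

lemma sum_monics_eFrac_mul {g u : F[X]} (hg : g.Monic) (hu : u.degree < g.degree) (m : ℕ) :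
    ∑ a ∈ monics F m, eFrac (u * a) g =
      if u.degree < (g.natDegree - m : ℕ) then
        (Fintype.card F : ℂ) ^ m * eChar F (u.coeff (g.natDegree - m - 1)) else 0 := by
  have hgd := degree_eq_natDegree hg.ne_zero
  simp only [sum_monics, mul_add, eFrac_add, ← Finset.mul_sum, sum_polysLT_eFrac_mul hg hu,
    mul_ite, mul_zero]
  split_ifs with h
  · rw [mul_comm]
    congr 1
    by_cases hu0 : u = 0
    · simp [hu0, eFrac]
    rw [degree_eq_natDegree hu0, Nat.cast_lt] at h
    have hn := natDegree_mul_le (p := u) (q := X ^ m)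
    rw [natDegree_X_pow] at hn
    rw [eFrac_of_degree_lt]
    · have : g.natDegree - 1 = (g.natDegree - m - 1) + m := by omega
      rw [this, coeff_mul_X_pow]
    · rw [hgd]
      exact degree_le_natDegree.trans_lt (by exact_mod_cast (by omega))
  · rfl

lemma sum_polysLT_natDegree_eFrac_mul {g : F[X]} (hg : g.Monic) (w : F[X]) :
    ∑ u ∈ polysLT F g.natDegree, eFrac (u * w) g =
      if g ∣ w then (Fintype.card F : ℂ) ^ g.natDegree else 0 := by
  have hd : g ∣ w - w % g := ⟨w / g, by
    rw [EuclideanDomain.mod_eq_sub_mul_div]; ring⟩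
  have h1 := sum_polysLT_eFrac_mul hg (degree_mod_lt w hg.ne_zero) (m := g.natDegree)
  simp only [Nat.sub_self, Nat.cast_zero, Nat.WithBot.lt_zero_iff, degree_eq_bot] at h1
  rw [Finset.sum_congr rfl fun u _ => eFrac_congr (b := w % g * u) ?_, h1]
  · simp [EuclideanDomain.mod_eq_zero]
  · rw [mul_comm (w % g), ← mul_sub]
    exact hd.mul_left u

end PolynomialSets

section DirichletCharacters

variable {F : Type} [Field F]

lemma IsDirichletChar.congr {ℓ : F[X]} {χ : F[X] → ℂ} (hχ : IsDirichletChar ℓ χ) {a b : F[X]}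
    (h : ℓ ∣ a - b) : χ a = χ b :=
  hχ.1 _ _ (mod_eq_of_dvd_sub h)

lemma IsDirichletChar.map_zero {ℓ : F[X]} {χ : F[X] → ℂ} (hχ : IsDirichletChar ℓ χ)
    (hℓ : ℓ.Monic) (hℓ1 : ℓ ≠ 1) : χ 0 = 0 := by
  rw [hχ.2.2.2, isCoprime_zero_left, hℓ.isUnit_iff]
  exact hℓ1

lemma isCoprime_of_dvd_mul_sub_one {a b ℓ : F[X]} (h : ℓ ∣ a * b - 1) : IsCoprime a ℓ := by
  obtain ⟨k, hk⟩ := h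
  exact ⟨b, -k, by linear_combination hk⟩

lemma IsCoprime.exists_dvd_mul_sub_one {a ℓ : F[X]} (h : IsCoprime a ℓ) :
    ∃ b, ℓ ∣ a * b - 1 := by
  obtain ⟨b, k, hk⟩ := h
  exact ⟨b, -k, by linear_combination hk⟩

lemma IsDirichletChar.map_mul_eq_one {ℓ : F[X]} {χ : F[X] → ℂ} (hχ : IsDirichletChar ℓ χ)
    {a b : F[X]} (h : ℓ ∣ a * b - 1) : χ a * χ b = 1 := by
  rw [← hχ.2.1, hχ.congr h, hχ.2.2.1]

/-- Units modulo a divisor of `ℓ` lift to units modulo `ℓ`. -/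
lemma exists_isCoprime_lift {ℓ ℓ' : F[X]} (hℓ : ℓ ≠ 0) {f : F[X]}
    (hf : IsCoprime f ℓ') : ∃ a, ℓ' ∣ a - f ∧ IsCoprime a ℓ := by
  set t := ∏ p ∈ (UniqueFactorizationMonoid.normalizedFactors ℓ).toFinset.filter
    (fun p => ¬ p ∣ f), p with ht
  refine ⟨f + t * ℓ', ⟨t, by ring⟩, isCoprime_of_prime_dvd (fun h => hℓ h.2) ?_⟩
  intro p hp hpa hpl
  obtain ⟨p', hp', hpp'⟩ :=
    UniqueFactorizationMonoid.exists_mem_normalizedFactors_of_dvd hℓ hp.irreducible hpl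
  by_cases hpf : p ∣ f
  · have h1 : p ∣ t * ℓ' := (dvd_add_right hpf).1 hpa
    rcases hp.dvd_or_dvd h1 with h2 | h2
    · rw [ht, hp.dvd_finsetProd_iff] at h2
      obtain ⟨r, hr, hpr⟩ := h2
      rw [Finset.mem_filter, Multiset.mem_toFinset] at hr
      have hass := hp.irreducible.associated_of_dvd
        (UniqueFactorizationMonoid.irreducible_of_normalized_factor r hr.1) hpr
      exact hr.2 (hass.symm.dvd.trans hpf)
    · exact hp.not_isUnit (hf.isUnit_of_dvd' hpf h2)
  · have h1 : p' ∣ t := Finset.dvd_prod_of_mem _ (by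
      rw [Finset.mem_filter, Multiset.mem_toFinset]
      exact ⟨hp', fun h => hpf (hpp'.dvd.trans h)⟩)
    exact hpf ((dvd_add_left ((hpp'.dvd.trans h1).mul_right ℓ')).1 hpa)

lemma IsPrimitiveChar.exists_ne_one {ℓ ℓ' : F[X]} {χ : F[X] → ℂ} (hχ : IsPrimitiveChar ℓ χ)
    (hℓ : ℓ ≠ 0) (hℓ' : ℓ'.Monic) (hdvd : ℓ' ∣ ℓ) (hne : ℓ' ≠ ℓ) :
    ∃ w, ℓ' ∣ w - 1 ∧ IsCoprime w ℓ ∧ χ w ≠ 1 := by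
  by_contra! hall
  have key : ∀ a b, IsCoprime a ℓ → IsCoprime b ℓ → ℓ' ∣ a - b → χ a = χ b := by
    intro a b ha hb hab
    obtain ⟨b', hb'⟩ := hb.exists_dvd_mul_sub_one
    have hb'c : IsCoprime b' ℓ := isCoprime_of_dvd_mul_sub_one (b := b) (by rwa [mul_comm])
    have h1 : χ (a * b') = 1 := by
      refine hall _ ?_ (ha.mul_left hb'c)
      have : a * b' - 1 = (a - b) * b' + (b * b' - 1) := by ring
      rw [this]
      exact dvd_add (hab.mul_right _) (hdvd.trans hb')
    have h2 := hχ.1.map_mul_eq_one hb'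
    rw [hχ.1.2.1] at h1
    exact mul_right_cancel₀ (fun h => (hχ.1.2.2.2 b').1 h hb'c) (h1.trans h2.symm)
  have hlift : ∀ f, ∃ a, IsCoprime f ℓ' → ℓ' ∣ a - f ∧ IsCoprime a ℓ := by
    intro f
    by_cases hf : IsCoprime f ℓ'
    · obtain ⟨a, ha⟩ := exists_isCoprime_lift hℓ hf
      exact ⟨a, fun _ => ha⟩
    · exact ⟨0, fun h => absurd h hf⟩
  choose lift hl using hlift
  have hval : ∀ f a, IsCoprime f ℓ' → IsCoprime a ℓ → ℓ' ∣ a - f → χ (lift f) = χ a := by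
    intro f a hf ha haf
    refine key _ _ (hl f hf).2 ha ?_
    have := dvd_sub (hl f hf).1 haf
    rwa [sub_sub_sub_cancel_right] at this
  have hcop : ∀ f g : F[X], f % ℓ' = g % ℓ' → IsCoprime f ℓ' → IsCoprime g ℓ' := by
    intro f g h hf
    have h1 : g = f + ℓ' * (g / ℓ' - f / ℓ') := by
      have h2 := EuclideanDomain.div_add_mod f ℓ'
      have h3 := EuclideanDomain.div_add_mod g ℓ'
      linear_combination h2 - h3 - h
    rw [h1]
    exact hf.add_mul_left_left _
  refine hχ.2 ℓ' hℓ' hdvd hne ⟨fun f => if IsCoprime f ℓ' then χ (lift f) else 0,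
    ⟨?_, ?_, ?_, ?_⟩, ?_⟩
  · intro f g h
    by_cases hf : IsCoprime f ℓ'
    · have hg := hcop f g h hf
      simp only [hf, hg, if_true]
      refine hval f _ hf (hl g hg).2 ?_
      have h1 : ℓ' ∣ g - f := ⟨g / ℓ' - f / ℓ', by
        have h2 := EuclideanDomain.div_add_mod f ℓ'
        have h3 := EuclideanDomain.div_add_mod g ℓ'
        linear_combination h2 - h3 - h⟩
      have := dvd_add (hl g hg).1 h1
      rwa [sub_add_sub_cancel] at this
    · have hg : ¬ IsCoprime g ℓ' := fun hg => hf (hcop g f h.symm hg)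
      simp only [hf, hg, if_false]
  · intro f g
    by_cases hf : IsCoprime f ℓ'
    · by_cases hg : IsCoprime g ℓ'
      · simp only [hf, hg, hf.mul_left hg, if_true]
        rw [← hχ.1.2.1]
        refine hval _ _ (hf.mul_left hg) ((hl f hf).2.mul_left (hl g hg).2) ?_
        have : lift f * lift g - f * g = (lift f - f) * lift g + f * (lift g - g) := by ring
        rw [this]
        exact dvd_add ((hl f hf).1.mul_right _) ((hl g hg).1.mul_left _)
      · have hfg : ¬ IsCoprime (f * g) ℓ' := fun h => hg h.of_mul_left_right
        simp only [hg, hfg, if_false, mul_zero]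
    · have hfg : ¬ IsCoprime (f * g) ℓ' := fun h => hf h.of_mul_left_left
      simp only [hf, hfg, if_false, zero_mul]
  · simp only [isCoprime_one_left, if_true]
    rw [hval 1 1 isCoprime_one_left isCoprime_one_left (by simp), hχ.1.2.2.1]
  · intro f
    by_cases hf : IsCoprime f ℓ'
    · simp only [hf, if_true, not_true, iff_false]
      exact fun h => (hχ.1.2.2.2 _).1 h (hl f hf).2
    · simp [hf]
  · intro f hf
    have hf' : IsCoprime f ℓ' := hf.of_isCoprime_of_dvd_right hdvd
    simp only [hf', if_true]
    exact (hval f f hf' hf (by simp)).symm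

variable [Fintype F]

lemma IsDirichletChar.norm_eq_one {ℓ : F[X]} {χ : F[X] → ℂ} (hχ : IsDirichletChar ℓ χ)
    (hℓ : ℓ.Monic) {a : F[X]} (ha : IsCoprime a ℓ) : ‖χ a‖ = 1 := by
  have hpow : ∀ n, χ (a ^ n) = χ a ^ n := by
    intro n
    induction n with
    | zero => simp [hχ.2.2.1]
    | succ n ih => rw [pow_succ, hχ.2.1, ih, pow_succ]
  have hχa : χ a ≠ 0 := fun h => (hχ.2.2.2 a).1 h ha
  obtain ⟨i, j, hij, h⟩ := Finite.exists_ne_map_eq_of_infinite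
    (fun n : ℕ => (⟨a ^ n % ℓ, by
      rw [mem_polysLT, ← degree_eq_natDegree hℓ.ne_zero]
      exact degree_mod_lt _ hℓ.ne_zero⟩ : polysLT F ℓ.natDegree))
  have h1 : χ a ^ i = χ a ^ j := by
    rw [← hpow, ← hpow]
    exact hχ.1 _ _ (congrArg Subtype.val h)
  wlog hlt : i < j generalizing i j
  · exact this j i hij.symm h.symm h1.symm (by omega)
  refine Complex.norm_eq_one_of_pow_eq_one (n := j - i) ?_ (by omega)
  refine mul_left_cancel₀ (pow_ne_zero i hχa) ?_
  rw [← pow_add, Nat.add_sub_cancel' hlt.le, mul_one, h1]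

lemma IsDirichletChar.conjChar_eq {ℓ : F[X]} {χ : F[X] → ℂ} (hχ : IsDirichletChar ℓ χ)
    (hℓ : ℓ.Monic) {a b : F[X]} (h : ℓ ∣ a * b - 1) : conjChar χ a = χ b := by
  have h1 := hχ.norm_eq_one hℓ (isCoprime_of_dvd_mul_sub_one h)
  have h2 : starRingEnd ℂ (χ a) * χ a = 1 := by
    rw [Complex.conj_mul', h1]
    simp
  calc conjChar χ a = starRingEnd ℂ (χ a) * (χ a * χ b) := by
        rw [hχ.map_mul_eq_one h, mul_one, conjChar]
    _ = χ b := by rw [← mul_assoc, h2, one_mul]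

lemma GSum_eq_sum {ℓ : F[X]} (hℓ : ℓ ≠ 0) (χ : F[X] → ℂ) :
    GSum ℓ χ = ∑ a ∈ polysLT F ℓ.natDegree, χ a * eFrac a ℓ := by
  have hfin : {a : F[X] | a.degree < ℓ.degree}.Finite := by
    rw [degree_eq_natDegree hℓ]
    exact finite_degree_lt F _
  rw [GSum, finsum_mem_eq_finite_toFinset_sum _ hfin]
  refine Finset.sum_congr ?_ fun _ _ => rfl
  ext a
  simp [degree_eq_natDegree hℓ]

/-- Multiplication by a unit permutes the residues modulo `ℓ`. -/
lemma sum_polysLT_mul_unit {ℓ : F[X]} (hℓ : ℓ ≠ 0) (H : F[X] → ℂ)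
    (hH : ∀ a b, ℓ ∣ a - b → H a = H b) {w w' : F[X]} (hw : ℓ ∣ w * w' - 1) :
    ∑ v ∈ polysLT F ℓ.natDegree, H (v * w) = ∑ v ∈ polysLT F ℓ.natDegree, H v := by
  have hmem : ∀ v, v % ℓ ∈ polysLT F ℓ.natDegree := fun v => by
    rw [mem_polysLT, ← degree_eq_natDegree hℓ]
    exact degree_mod_lt _ hℓ
  have hcancel : ∀ x y v : F[X], ℓ ∣ x * y - 1 → v ∈ polysLT F ℓ.natDegree →
      (v * x % ℓ) * y % ℓ = v := by
    intro x y v hxy hv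
    rw [mem_polysLT, ← degree_eq_natDegree hℓ] at hv
    nth_rewrite 2 [← (mod_eq_self_iff hℓ).2 hv]
    refine mod_eq_of_dvd_sub ?_
    have h1 : v * x % ℓ = v * x - ℓ * (v * x / ℓ) := EuclideanDomain.mod_eq_sub_mul_div _ _
    have : v * x % ℓ * y - v = v * (x * y - 1) - ℓ * (v * x / ℓ * y) := by
      rw [h1]; ring
    rw [this]
    exact dvd_sub (hxy.mul_left _) (dvd_mul_right _ _)
  refine Finset.sum_bij' (fun v _ => v * w % ℓ) (fun v _ => v * w' % ℓ)
    (fun _ _ => hmem _) (fun _ _ => hmem _) (fun v hv => hcancel w w' v hw hv)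
    (fun v hv => hcancel w' w v (by rwa [mul_comm]) hv) fun v _ => hH _ _ ⟨v * w / ℓ, ?_⟩
  rw [EuclideanDomain.mod_eq_sub_mul_div]
  ring

lemma IsPrimitiveChar.sum_mul_eFrac {ℓ : F[X]} {χ : F[X] → ℂ} (hχ : IsPrimitiveChar ℓ χ)
    (hℓ : ℓ.Monic) (a : F[X]) :
    ∑ v ∈ polysLT F ℓ.natDegree, χ v * eFrac (v * a) ℓ = conjChar χ a * GSum ℓ χ := by
  have hper : ∀ b x y : F[X], ℓ ∣ x - y →
      χ x * eFrac (x * b) ℓ = χ y * eFrac (y * b) ℓ := by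
    intro b x y h
    rw [hχ.1.congr h, eFrac_congr (a := x * b) (b := y * b)]
    rw [← sub_mul]
    exact h.mul_right b
  by_cases ha : IsCoprime a ℓ
  · obtain ⟨b, hb⟩ := ha.exists_dvd_mul_sub_one
    rw [hχ.1.conjChar_eq hℓ hb, GSum_eq_sum hℓ.ne_zero,
      ← sum_polysLT_mul_unit hℓ.ne_zero (fun v => χ v * eFrac v ℓ)
        (by simpa using hper 1) hb, Finset.mul_sum]
    refine Finset.sum_congr rfl fun v _ => ?_
    rw [hχ.1.2.1 v a]
    linear_combination (-χ v * eFrac (v * a) ℓ) * hχ.1.map_mul_eq_one hb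
  · have h0 : conjChar χ a = 0 := by
      rw [conjChar, (hχ.1.2.2.2 a).2 ha, _root_.map_zero]
    rw [h0, zero_mul]
    have hgd := EuclideanDomain.gcd_dvd_right a ℓ
    have hg0 : EuclideanDomain.gcd a ℓ ≠ 0 := fun h => hℓ.ne_zero (by
      rw [h] at hgd; exact zero_dvd_iff.1 hgd)
    obtain ⟨ℓ', hℓ', h', hh', hprod, hdvd⟩ : ∃ ℓ' : F[X], ∃ _ : ℓ'.Monic, ∃ h', ¬ IsUnit h' ∧
        ℓ = ℓ' * h' ∧ h' ∣ a := by
      obtain ⟨k, hk⟩ := hgd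
      have hk0 : k ≠ 0 := by
        rintro rfl
        exact hℓ.ne_zero (by rw [hk, mul_zero])
      have hlc : C k.leadingCoeff * C k.leadingCoeff⁻¹ = (1 : F[X]) := by
        rw [← C_mul, mul_inv_cancel₀ (leadingCoeff_ne_zero.2 hk0), C_1]
      refine ⟨k * C k.leadingCoeff⁻¹, monic_mul_leadingCoeff_inv hk0,
        EuclideanDomain.gcd a ℓ * C k.leadingCoeff, ?_, ?_, ?_⟩
      · intro hu
        exact ha (EuclideanDomain.gcd_isUnit_iff.1 (isUnit_of_mul_isUnit_left hu))
      · nth_rewrite 1 [hk]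
        linear_combination (-EuclideanDomain.gcd a ℓ * k) * hlc
      · refine (Associated.dvd ?_).trans (EuclideanDomain.gcd_dvd_left a ℓ)
        exact associated_mul_unit_left _ _ (IsUnit.of_mul_eq_one _ hlc)
    have hne : ℓ' ≠ ℓ := by
      rintro rfl
      refine hh' (IsUnit.of_mul_eq_one 1 ?_)
      exact mul_left_cancel₀ hℓ.ne_zero (by rw [mul_one, mul_one, ← hprod])
    obtain ⟨w, hw1, hw2, hw3⟩ := hχ.exists_ne_one hℓ.ne_zero hℓ' ⟨h', hprod⟩ hne
    obtain ⟨w', hw'⟩ := hw2.exists_dvd_mul_sub_one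
    have h1 := sum_polysLT_mul_unit hℓ.ne_zero _ (hper a) hw'
    have h2 : ∀ v, χ (v * w) * eFrac (v * w * a) ℓ = χ w * (χ v * eFrac (v * a) ℓ) := by
      intro v
      rw [hχ.1.2.1, eFrac_congr (a := v * w * a) (b := v * a)]
      · ring
      · have : v * w * a - v * a = v * ((w - 1) * a) := by ring
        rw [this, hprod]
        exact (mul_dvd_mul hw1 hdvd).mul_left v
    simp only [h2, ← Finset.mul_sum] at h1
    have h3 : (χ w - 1) * ∑ v ∈ polysLT F ℓ.natDegree, χ v * eFrac (v * a) ℓ = 0 := by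
      linear_combination h1
    exact (mul_eq_zero.1 h3).resolve_left (sub_ne_zero.2 hw3)

/-- The sum of `χ` over polynomials of degree less than `m`, twisted by the additive character of
the top coefficient. -/
noncomputable def topTwistSum (χ : F[X] → ℂ) (m : ℕ) : ℂ :=
  ∑ v ∈ polysLT F m, χ v * eChar F (v.coeff (m - 1))

lemma polysLT_zero : polysLT F 0 = {0} := by
  ext f
  simp [Nat.WithBot.lt_zero_iff]

lemma topTwistSum_zero {χ : F[X] → ℂ} (h : χ 0 = 0) : topTwistSum χ 0 = 0 := by
  simp [topTwistSum, polysLT_zero, h]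

lemma IsPrimitiveChar.GSum_mul_sum_monics {ℓ : F[X]} {χ : F[X] → ℂ} (hχ : IsPrimitiveChar ℓ χ)
    (hℓ : ℓ.Monic) (r : ℕ) :
    GSum ℓ χ * ∑ a ∈ monics F r, conjChar χ a =
      (Fintype.card F : ℂ) ^ r * topTwistSum χ (ℓ.natDegree - r) := by
  have h1 : GSum ℓ χ * ∑ a ∈ monics F r, conjChar χ a =
      ∑ v ∈ polysLT F ℓ.natDegree, χ v * ∑ a ∈ monics F r, eFrac (v * a) ℓ := by
    simp only [Finset.mul_sum]
    rw [Finset.sum_comm]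
    refine Finset.sum_congr rfl fun a _ => ?_
    rw [hχ.sum_mul_eFrac hℓ, mul_comm]
  rw [h1, topTwistSum, Finset.mul_sum]
  have hsub : polysLT F (ℓ.natDegree - r) ⊆ polysLT F ℓ.natDegree := by
    intro f hf
    rw [mem_polysLT] at *
    exact hf.trans_le (by exact_mod_cast Nat.sub_le _ _)
  symm
  refine Finset.sum_subset_zero_on_sdiff hsub ?_ ?_
  · intro v hv
    rw [Finset.mem_sdiff, mem_polysLT, mem_polysLT] at hv
    rw [sum_monics_eFrac_mul hℓ (by rw [degree_eq_natDegree hℓ.ne_zero]; exact hv.1),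
      if_neg hv.2, mul_zero]
  · intro v hv
    have hv' := mem_polysLT.1 (hsub hv)
    rw [mem_polysLT] at hv
    rw [sum_monics_eFrac_mul hℓ (by rw [degree_eq_natDegree hℓ.ne_zero]; exact hv'), if_pos hv]
    ring

lemma IsDirichletChar.topTwistSum_eq_zero {ℓ : F[X]} {χ : F[X] → ℂ} (hχ : IsDirichletChar ℓ χ)
    (hℓ : ℓ.Monic) {m : ℕ} (hm : ℓ.natDegree < m) : topTwistSum χ m = 0 :=
  sum_polysLT_mul_eChar_coeff_eq_zero hℓ hm χ fun f k => hχ.congr (by simp)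

lemma IsPrimitiveChar.sum_topTwistSum {ℓ : F[X]} {χ : F[X] → ℂ} (hχ : IsPrimitiveChar ℓ χ)
    (hℓ : ℓ.Monic) (hℓ1 : ℓ ≠ 1) {d : ℕ} (hd : ℓ.natDegree ≤ d) :
    ∑ m ∈ Finset.range (d + 1), topTwistSum χ m = GSum ℓ χ * LFun (conjChar χ) 1 := by
  have h0 := topTwistSum_zero (hχ.1.map_zero hℓ hℓ1)
  have hq : (Fintype.card F : ℂ) ≠ 0 := by exact_mod_cast Fintype.card_ne_zero
  have hterm : ∀ n : ℕ, GSum ℓ χ *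
      ((∑ᶠ f ∈ {f : F[X] | f.Monic ∧ f.natDegree = n}, conjChar χ f) *
        (Fintype.card F : ℂ) ^ (-((1 : ℂ) * (n : ℂ)))) = topTwistSum χ (ℓ.natDegree - n) := by
    intro n
    rw [finsum_monics, ← mul_assoc, hχ.GSum_mul_sum_monics hℓ, one_mul, Complex.cpow_neg,
      Complex.cpow_natCast]
    field_simp
  rw [LFun, ← tsum_mul_left]
  simp only [hterm]
  rw [tsum_eq_sum (s := Finset.range (ℓ.natDegree + 1)) fun n hn => ?_]
  · have := Finset.sum_range_reflect (topTwistSum χ) (ℓ.natDegree + 1)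
    simp only [Nat.add_sub_cancel] at this
    rw [this]
    symm
    refine Finset.sum_subset (by simpa using hd) fun m _ hm => ?_
    exact hχ.1.topTwistSum_eq_zero hℓ (by simpa using hm)
  · rw [Finset.mem_range] at hn
    rw [Nat.sub_eq_zero_of_le (by omega), h0]

end DirichletCharacters

section DivisorSums

variable {F : Type} [Field F] [Fintype F]

lemma rChi_eq_sum (χ : F[X] → ℂ) {f : F[X]} (hf : f ≠ 0) (n : ℕ) (hn : f.natDegree = n) :
    rChi χ f = ∑ p ∈ Finset.HasAntidiagonal.antidiagonal n, ∑ a ∈ (monics F p.1).filter (· ∣ f), χ a := by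
  have hfin : {g : F[X] | g.Monic ∧ g ∣ f}.Finite :=
    (finite_degree_lt F (n + 1)).subset fun g hg => by
      refine (degree_le_of_dvd hg.2 hf).trans_lt (degree_le_natDegree.trans_lt ?_)
      exact_mod_cast (by omega)
  rw [rChi, finsum_mem_eq_finite_toFinset_sum _ hfin, Finset.Nat.sum_antidiagonal_eq_sum_range_succ
    (fun i _ => ∑ a ∈ (monics F i).filter (· ∣ f), χ a)]
  rw [← Finset.sum_fiberwise_of_maps_to (t := Finset.range n.succ) (g := natDegree)]
  · refine Finset.sum_congr rfl fun i _ => Finset.sum_congr ?_ fun _ _ => rfl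
    ext a
    simp only [Finset.mem_filter, Set.Finite.mem_toFinset, Set.mem_ofPred_eq, mem_monics]
    tauto
  · intro a ha
    rw [Set.Finite.mem_toFinset] at ha
    have := natDegree_le_of_dvd ha.2 hf
    rw [Finset.mem_range]
    omega

lemma sum_monics_rChi_mul (χ H : F[X] → ℂ) (n : ℕ) :
    ∑ f ∈ monics F n, rChi χ f * H f = ∑ p ∈ Finset.HasAntidiagonal.antidiagonal n,
      ∑ a ∈ monics F p.1, ∑ b ∈ monics F p.2, χ a * H (a * b) := by
  have h1 : ∀ f ∈ monics F n, rChi χ f * H f = ∑ p ∈ Finset.HasAntidiagonal.antidiagonal n,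
      ∑ a ∈ monics F p.1, if a ∣ f then χ a * H f else 0 := by
    intro f hf
    rw [mem_monics] at hf
    rw [rChi_eq_sum χ hf.1.ne_zero n hf.2]
    simp only [Finset.sum_filter, Finset.sum_mul, ite_mul, zero_mul]
  rw [Finset.sum_congr rfl h1, Finset.sum_comm]
  refine Finset.sum_congr rfl fun p hp => ?_
  rw [Finset.HasAntidiagonal.mem_antidiagonal] at hp
  rw [Finset.sum_comm]
  refine Finset.sum_congr rfl fun a ha => ?_
  rw [mem_monics] at ha
  rw [← Finset.sum_filter]
  symm
  refine Finset.sum_bij (fun b _ => a * b) ?_ ?_ ?_ fun _ _ => rfl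
  · intro b hb
    rw [mem_monics] at hb
    rw [Finset.mem_filter, mem_monics]
    refine ⟨⟨ha.1.mul hb.1, ?_⟩, dvd_mul_right _ _⟩
    rw [ha.1.natDegree_mul hb.1]
    omega
  · intro b _ b' _ h
    exact mul_left_cancel₀ ha.1.ne_zero h
  · intro f hf
    rw [Finset.mem_filter, mem_monics] at hf
    obtain ⟨⟨hfm, hfd⟩, b, rfl⟩ := hf
    have hb := ha.1.of_mul_monic_left hfm
    rw [ha.1.natDegree_mul hb] at hfd
    exact ⟨b, mem_monics.2 ⟨hb, by omega⟩, rfl⟩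

lemma sum_polysLT_sdiff_zero (m : ℕ) (H : F[X] → ℂ) :
    ∑ u ∈ polysLT F m \ {0}, H u =
      ∑ k ∈ Finset.range m, ∑ γ : Fˣ, ∑ a ∈ monics F k, H (C (γ : F) * a) := by
  rw [← Finset.sum_fiberwise_of_maps_to (t := Finset.range m) (g := natDegree)]
  · refine Finset.sum_congr rfl fun k hk => ?_
    rw [Finset.mem_range] at hk
    rw [← Finset.sum_product']
    symm
    refine Finset.sum_bij (fun x _ => C (x.1 : F) * x.2) ?_ ?_ ?_ fun _ _ => rfl
    · rintro ⟨γ, a⟩ h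
      simp only [Finset.mem_product, Finset.mem_univ, mem_monics, true_and] at h
      have hnd : (C (γ : F) * a).natDegree = k := by
        rw [natDegree_C_mul γ.ne_zero, h.2]
      have h0 : C (γ : F) * a ≠ 0 := mul_ne_zero (C_ne_zero.2 γ.ne_zero) h.1.ne_zero
      simp only [Finset.mem_filter, Finset.mem_sdiff, mem_polysLT, Finset.mem_singleton]
      refine ⟨⟨?_, h0⟩, hnd⟩
      rw [degree_eq_natDegree h0, hnd]
      exact_mod_cast hk
    · rintro ⟨γ, a⟩ h ⟨γ', a'⟩ h' heq
      simp only [Finset.mem_product, Finset.mem_univ, mem_monics, true_and] at h h' heq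
      have hlc := congrArg leadingCoeff heq
      rw [leadingCoeff_mul, leadingCoeff_mul, h.1.leadingCoeff, h'.1.leadingCoeff,
        leadingCoeff_C, leadingCoeff_C, mul_one, mul_one] at hlc
      rw [hlc] at heq
      rw [Units.ext hlc, mul_left_cancel₀ (C_ne_zero.2 γ'.ne_zero) heq]
    · intro u hu
      simp only [Finset.mem_filter, Finset.mem_sdiff, mem_polysLT, Finset.mem_singleton] at hu
      obtain ⟨⟨-, hu0⟩, hud⟩ := hu
      have hl := leadingCoeff_ne_zero.2 hu0
      refine ⟨(Units.mk0 _ hl, u * C u.leadingCoeff⁻¹), ?_, ?_⟩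
      · simp only [Finset.mem_product, Finset.mem_univ, mem_monics, true_and]
        refine ⟨monic_mul_leadingCoeff_inv hu0, ?_⟩
        rw [natDegree_mul_C (inv_ne_zero hl), hud]
      · rw [Units.val_mk0, mul_left_comm, ← C_mul, mul_inv_cancel₀ hl, C_1, mul_one]
  · intro u hu
    simp only [Finset.mem_sdiff, mem_polysLT, Finset.mem_singleton] at hu
    rw [degree_eq_natDegree hu.2, Nat.cast_lt] at hu
    exact Finset.mem_range.2 hu.1

end DivisorSums

section Combinatorics

lemma sum_antidiagonal_range_range (N : ℕ) (Φ : ℕ → ℕ → ℕ → ℕ → ℂ) :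
    ∑ p ∈ Finset.HasAntidiagonal.antidiagonal N, ∑ k₁ ∈ Finset.range p.1, ∑ k₂ ∈ Finset.range p.2,
        Φ k₁ k₂ (p.1 - 1 - k₁) (p.2 - 1 - k₂) =
      ∑ k ∈ Finset.range (N - 1), ∑ p ∈ Finset.HasAntidiagonal.antidiagonal k,
        ∑ s ∈ Finset.HasAntidiagonal.antidiagonal (N - 2 - k), Φ p.2 p.1 s.2 s.1 := by
  simp only [Finset.sum_sigma']
  refine Finset.sum_bij'
    (fun x _ => ⟨x.2.1 + x.2.2, ⟨(x.2.2, x.2.1), (x.1.2 - 1 - x.2.2, x.1.1 - 1 - x.2.1)⟩⟩)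
    (fun y _ => ⟨(y.2.1.2 + y.2.2.2 + 1, y.2.1.1 + y.2.2.1 + 1), ⟨y.2.1.2, y.2.1.1⟩⟩)
    ?_ ?_ ?_ ?_ ?_
  · rintro ⟨⟨a, b⟩, ⟨k₁, k₂⟩⟩ h
    simp only [Finset.mem_sigma, Finset.HasAntidiagonal.mem_antidiagonal, Finset.mem_range] at h ⊢
    omega
  · rintro ⟨k, ⟨⟨a, b⟩, ⟨s, t⟩⟩⟩ h
    simp only [Finset.mem_sigma, Finset.HasAntidiagonal.mem_antidiagonal, Finset.mem_range] at h ⊢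
    omega
  · rintro ⟨⟨a, b⟩, ⟨k₁, k₂⟩⟩ h
    simp only [Finset.mem_sigma, Finset.HasAntidiagonal.mem_antidiagonal, Finset.mem_range] at h
    have h1 : k₁ + (a - 1 - k₁) + 1 = a := by omega
    have h2 : k₂ + (b - 1 - k₂) + 1 = b := by omega
    simp only [h1, h2]
  · rintro ⟨k, ⟨⟨a, b⟩, ⟨s, t⟩⟩⟩ h
    simp only [Finset.mem_sigma, Finset.HasAntidiagonal.mem_antidiagonal, Finset.mem_range] at h
    obtain ⟨-, rfl, -⟩ := h
    have h1 : b + t + 1 - 1 - b = t := by omega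
    have h2 : a + s + 1 - 1 - a = s := by omega
    simp only [h1, h2, add_comm b a]
  · intros
    rfl

lemma sum_antidiagonal_eq_sum_negBinom (K : ℕ) (H : ℕ → ℕ → ℂ) :
    ∑ s ∈ Finset.HasAntidiagonal.antidiagonal K, H (if s.1 = 0 then 0 else 1) (if s.2 = 0 then 0 else 1) =
      ∑ η₁ ∈ Finset.range 2, ∑ η₂ ∈ Finset.range 2, (-1 : ℂ) ^ (K - η₁ - η₂) * H η₁ η₂ *
        (if η₁ + η₂ ≤ K then (negBinom (η₁ + η₂) (K - η₁ - η₂) : ℂ) else 0) := by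
  have hsq : ∀ n : ℕ, ((-1 : ℂ) ^ n) * (-1) ^ n = 1 := fun n => by
    rw [← mul_pow]; norm_num
  match K with
  | 0 => simp [Finset.sum_range_succ, negBinom]
  | 1 => simp [Finset.sum_range_succ, negBinom, Finset.Nat.antidiagonal_succ]
  | n + 2 =>
    rw [Finset.Nat.antidiagonal_succ_succ']
    have hch : (1 + n).choose n = n + 1 := by
      rw [add_comm, Nat.choose_succ_self_right]
    simp [Finset.sum_range_succ, negBinom, hch]
    have h1 := hsq n
    rw [pow_succ]
    linear_combination (-(H 1 0 + H 0 1) - (n + 1) * H 1 1) * h1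

lemma sum_antidiagonal_sub (t : ℕ → ℂ) (ht : t 0 = 0) (d n : ℕ) :
    ∑ p ∈ Finset.HasAntidiagonal.antidiagonal n, t (d - p.2) + ∑ m ∈ Finset.range (d - n), t m =
      ∑ m ∈ Finset.range (d + 1), t m := by
  rw [← Finset.Nat.sum_antidiagonal_swap, Finset.Nat.sum_antidiagonal_eq_sum_range_succ_mk]
  simp only [Prod.swap_prod_mk]
  induction n with
  | zero => simp [Finset.sum_range_succ, add_comm]
  | succ n ih =>
    rw [← ih, Finset.sum_range_succ _ n.succ]
    rcases Nat.lt_or_ge n d with h | h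
    · have : d - n = d - (n + 1) + 1 := by omega
      rw [this, Finset.sum_range_succ _ (d - (n + 1))]
      ring
    · have h1 : d - n = 0 := by omega
      have h2 : d - (n + 1) = 0 := by omega
      simp [h1, h2, ht]

/-- Comparing the sum of `D` over a full antidiagonal with the sum over its part in a box. -/
lemma sum_antidiagonal_eq_of_vanish (D : ℕ → ℕ → ℂ) (t : ℕ → ℂ) (d n : ℕ)
    (hD1 : ∀ m, D 0 m = 0) (hD2 : ∀ m, D m 0 = 0) (hD3 : ∀ a b, d < b → D a b = 0)
    (hD4 : ∀ a b, d < a → D a b = -t b) :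
    ∑ p ∈ Finset.HasAntidiagonal.antidiagonal (2 * d - n), D p.1 p.2 =
      ∑ p ∈ Finset.HasAntidiagonal.antidiagonal n, D (d - p.1) (d - p.2) - ∑ m ∈ Finset.range (d - n), t m := by
  rw [← Finset.sum_filter_add_sum_filter_not (Finset.HasAntidiagonal.antidiagonal (2 * d - n)) (fun p => d < p.1),
    sub_eq_add_neg, add_comm, ← Finset.sum_neg_distrib]
  congr 1
  · rw [← Finset.sum_filter_of_ne (s := Finset.HasAntidiagonal.antidiagonal n)
      (p := fun p => p.1 < d ∧ p.2 < d)]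
    · rw [← Finset.sum_filter_of_ne (s := (Finset.HasAntidiagonal.antidiagonal (2 * d - n)).filter _)
        (p := fun p => p.1 ≠ 0 ∧ p.2 ≠ 0 ∧ p.2 ≤ d)]
      · refine Finset.sum_bij' (fun p _ => (d - p.1, d - p.2)) (fun p _ => (d - p.1, d - p.2))
          ?_ ?_ ?_ ?_ ?_
        all_goals
          rintro ⟨a, b⟩ h
          simp only [Finset.mem_filter, Finset.HasAntidiagonal.mem_antidiagonal] at h
        · simp only [Finset.mem_filter, Finset.HasAntidiagonal.mem_antidiagonal]
          omega
        · simp only [Finset.mem_filter, Finset.HasAntidiagonal.mem_antidiagonal]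
          omega
        · simp only [Prod.mk.injEq]
          omega
        · simp only [Prod.mk.injEq]
          omega
        · have h1 : d - (d - a) = a := by omega
          have h2 : d - (d - b) = b := by omega
          simp only [h1, h2]
      · rintro ⟨a, b⟩ - hne
        refine ⟨?_, ?_, ?_⟩
        · rintro rfl
          exact hne (hD1 _)
        · rintro rfl
          exact hne (hD2 _)
        · by_contra! hb
          exact hne (hD3 _ _ hb)
    · rintro ⟨a, b⟩ - hne
      constructor
      · by_contra! ha
        exact hne (by rw [Nat.sub_eq_zero_of_le ha, hD1])
      · by_contra! hb
        exact hne (by rw [Nat.sub_eq_zero_of_le hb, hD2])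
  · refine Finset.sum_bij' (fun p _ => p.2) (fun m _ => (2 * d - n - m, m)) ?_ ?_ ?_ ?_ ?_
    · rintro ⟨a, b⟩ h
      simp only [Finset.mem_filter, Finset.HasAntidiagonal.mem_antidiagonal, Finset.mem_range] at h ⊢
      omega
    · intro m h
      simp only [Finset.mem_filter, Finset.HasAntidiagonal.mem_antidiagonal, Finset.mem_range] at h ⊢
      omega
    · rintro ⟨a, b⟩ h
      simp only [Finset.mem_filter, Finset.HasAntidiagonal.mem_antidiagonal] at h
      simp only [Prod.mk.injEq, and_true]
      omega
    · intros
      rfl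
    · rintro ⟨a, b⟩ h
      simp only [Finset.mem_filter] at h
      exact hD4 _ _ h.2

end Combinatorics

section Voronoi

variable {F : Type} [Field F] [Fintype F]

/-- The double sum over `deg u < M₁`, `deg v < M₂`, `u ≠ 0`, arising from Poisson summation. -/
noncomputable def dualBoxSum (χ : F[X] → ℂ) (g x : F[X]) (M₁ M₂ : ℕ) : ℂ :=
  ∑ u ∈ polysLT F M₁ \ {0}, ∑ v ∈ polysLT F M₂, χ v * eFrac (-(x * (u * v))) g *
    (eChar F (u.coeff (M₁ - 1)) * eChar F (v.coeff (M₂ - 1)))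

lemma dualBoxSum_zero_left (χ : F[X] → ℂ) (g x : F[X]) (m : ℕ) : dualBoxSum χ g x 0 m = 0 := by
  simp [dualBoxSum, polysLT_zero]

lemma dualBoxSum_zero_right {χ : F[X] → ℂ} (h : χ 0 = 0) (g x : F[X]) (m : ℕ) :
    dualBoxSum χ g x m 0 = 0 := by
  simp [dualBoxSum, polysLT_zero, h]

lemma dualBoxSum_of_lt_right {ℓ g : F[X]} {χ : F[X] → ℂ} (hχ : IsDirichletChar ℓ χ)
    (hg : g.Monic) (hdvd : ℓ ∣ g) (x : F[X]) {M₁ M₂ : ℕ} (h : g.natDegree < M₂) :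
    dualBoxSum χ g x M₁ M₂ = 0 := by
  refine Finset.sum_eq_zero fun u _ => ?_
  rw [← sum_polysLT_mul_eChar_coeff_eq_zero hg h
    (fun v => χ v * eFrac (-(x * (u * v))) g * eChar F (u.coeff (M₁ - 1))) fun f k => ?_]
  · exact Finset.sum_congr rfl fun v _ => by ring
  · have h1 : χ (f + k * g) = χ f := hχ.congr (by
      rw [add_sub_cancel_left]; exact hdvd.mul_left k)
    have h2 : eFrac (-(x * (u * (f + k * g)))) g = eFrac (-(x * (u * f))) g :=
      eFrac_congr ⟨-(x * u * k), by ring⟩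
    rw [h1, h2]

lemma sum_polysLT_eq_topTwistSum_add_dualBoxSum (χ : F[X] → ℂ) (g x : F[X]) (M₁ M₂ : ℕ) :
    ∑ u ∈ polysLT F M₁, ∑ v ∈ polysLT F M₂, χ v * eFrac (-(x * (u * v))) g *
      (eChar F (u.coeff (M₁ - 1)) * eChar F (v.coeff (M₂ - 1))) =
    topTwistSum χ M₂ + dualBoxSum χ g x M₁ M₂ := by
  have h0 : ({0} : Finset F[X]) ⊆ polysLT F M₁ := by
    simp [Finset.singleton_subset_iff]
  rw [← Finset.sum_sdiff h0, add_comm, Finset.sum_singleton, dualBoxSum, topTwistSum]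
  congr 1
  refine Finset.sum_congr rfl fun v _ => ?_
  simp [eFrac_eq_one_of_dvd]

lemma dualBoxSum_of_lt_left (χ : F[X] → ℂ) {g : F[X]}
    (hg : g.Monic) (x : F[X]) {M₁ M₂ : ℕ} (h : g.natDegree < M₁) :
    dualBoxSum χ g x M₁ M₂ = -topTwistSum χ M₂ := by
  rw [eq_neg_iff_add_eq_zero, add_comm, ← sum_polysLT_eq_topTwistSum_add_dualBoxSum,
    Finset.sum_comm]
  refine Finset.sum_eq_zero fun v _ => ?_
  rw [← sum_polysLT_mul_eChar_coeff_eq_zero hg h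
    (fun u => χ v * eFrac (-(x * (u * v))) g * eChar F (v.coeff (M₂ - 1))) fun f k => ?_]
  · exact Finset.sum_congr rfl fun v _ => by ring
  · rw [eFrac_congr (a := -(x * ((f + k * g) * v))) (b := -(x * (f * v)))]
    exact ⟨-(x * k * v), by ring⟩

/-- Fourier self-duality of `(a, b) ↦ χ(a) e(cab/g)` for `χ` periodic modulo `g`. -/
lemma IsDirichletChar.sum_sum_eFrac {ℓ g c x : F[X]} {χ : F[X] → ℂ} (hχ : IsDirichletChar ℓ χ)
    (hg : g.Monic) (hdvd : ℓ ∣ g) (hx : g ∣ c * x - 1) (a b : F[X]) :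
    ∑ u ∈ polysLT F g.natDegree, ∑ v ∈ polysLT F g.natDegree,
      χ v * eFrac (-(x * (u * v))) g * (eFrac (u * a) g * eFrac (v * b) g) =
    (Fintype.card F : ℂ) ^ g.natDegree * (χ (c * a) * eFrac (c * (a * b)) g) := by
  have h1 : ∀ u v : F[X], χ v * eFrac (-(x * (u * v))) g * (eFrac (u * a) g * eFrac (v * b) g) =
      χ v * eFrac (v * b) g * eFrac (u * (a - x * v)) g := by
    intro u v
    have : u * (a - x * v) = -(x * (u * v)) + u * a := by ring
    rw [this, eFrac_add]
    ring
  simp only [h1]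
  rw [Finset.sum_comm]
  simp only [← Finset.mul_sum, sum_polysLT_natDegree_eFrac_mul hg]
  have hmod : g ∣ c * a % g - c * a := ⟨-(c * a / g), by
    rw [EuclideanDomain.mod_eq_sub_mul_div]; ring⟩
  obtain ⟨k, hk⟩ := hx
  rw [Finset.sum_eq_single (c * a % g)]
  · rw [if_pos, hχ.congr (hdvd.trans hmod), eFrac_congr (a := c * a % g * b) (b := c * (a * b))]
    · ring
    · obtain ⟨m, hm⟩ := hmod
      exact ⟨m * b, by linear_combination b * hm⟩
    · obtain ⟨m, hm⟩ := hmod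
      exact ⟨-(k * a) - x * m, by linear_combination -a * hk - x * hm⟩
  · intro v hv hne
    rw [if_neg, mul_zero]
    rintro ⟨m, hm⟩
    apply hne
    rw [mem_polysLT, ← degree_eq_natDegree hg.ne_zero] at hv
    rw [← (mod_eq_self_iff hg.ne_zero).2 hv]
    refine mod_eq_of_dvd_sub ⟨-(k * v) - c * m, ?_⟩
    linear_combination (-v) * hk - c * hm
  · intro h
    refine absurd ?_ h
    rw [mem_polysLT, ← degree_eq_natDegree hg.ne_zero]
    exact degree_mod_lt _ hg.ne_zero

lemma IsDirichletChar.sum_monics_sum_monics {ℓ g c x : F[X]} {χ : F[X] → ℂ}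
    (hχ : IsDirichletChar ℓ χ) (hg : g.Monic) (hdvd : ℓ ∣ g) (hx : g ∣ c * x - 1) (i j : ℕ) :
    ∑ a ∈ monics F i, ∑ b ∈ monics F j, χ a * eFrac (c * (a * b)) g =
      (Fintype.card F : ℂ) ^ (i + j) / (Fintype.card F : ℂ) ^ g.natDegree * χ x *
        (topTwistSum χ (g.natDegree - j) +
          dualBoxSum χ g x (g.natDegree - i) (g.natDegree - j)) := by
  have hq : (Fintype.card F : ℂ) ≠ 0 := by exact_mod_cast Fintype.card_ne_zero
  set d := g.natDegree with hd
  have hdeg : g.degree = (d : WithBot ℕ) := degree_eq_natDegree hg.ne_zero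
  have hsub : ∀ r, polysLT F (d - r) ⊆ polysLT F d := fun r f hf => by
    rw [mem_polysLT] at *
    exact hf.trans_le (by exact_mod_cast Nat.sub_le _ _)
  have hA : ∀ (r : ℕ) (f : F[X]), f ∈ polysLT F d → f ∉ polysLT F (d - r) →
      ∑ a ∈ monics F r, eFrac (f * a) g = 0 := fun r f hf hf' => by
    rw [mem_polysLT, ← hdeg] at hf
    rw [mem_polysLT] at hf'
    rw [sum_monics_eFrac_mul hg hf, if_neg hf']
  have hB : ∀ (r : ℕ) (f : F[X]), f ∈ polysLT F (d - r) →
      ∑ a ∈ monics F r, eFrac (f * a) g =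
        (Fintype.card F : ℂ) ^ r * eChar F (f.coeff (d - r - 1)) := fun r f hf => by
    have hf' := hsub r hf
    rw [mem_polysLT, ← hdeg] at hf'
    rw [mem_polysLT] at hf
    rw [sum_monics_eFrac_mul hg hf', if_pos hf]
  have hZ1 : ∑ u ∈ polysLT F d, ∑ v ∈ polysLT F d, χ v * eFrac (-(x * (u * v))) g *
      ((∑ a ∈ monics F i, eFrac (u * a) g) * ∑ b ∈ monics F j, eFrac (v * b) g) =
      (Fintype.card F : ℂ) ^ (i + j) * (topTwistSum χ (d - j) +
        dualBoxSum χ g x (d - i) (d - j)) := by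
    rw [← sum_polysLT_eq_topTwistSum_add_dualBoxSum]
    simp only [Finset.mul_sum (a := (Fintype.card F : ℂ) ^ (i + j))]
    symm
    refine Finset.sum_subset_zero_on_sdiff (hsub i) (fun u hu => ?_) fun u hu => ?_
    · rw [Finset.mem_sdiff] at hu
      simp only [hA i u hu.1 hu.2, zero_mul, mul_zero, Finset.sum_const_zero]
    refine Finset.sum_subset_zero_on_sdiff (hsub j) (fun v hv => ?_) fun v hv => ?_
    · rw [Finset.mem_sdiff] at hv
      simp only [hA j v hv.1 hv.2, mul_zero]
    · rw [hB i u hu, hB j v hv]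
      ring
  have hZ2 : ∑ u ∈ polysLT F d, ∑ v ∈ polysLT F d, χ v * eFrac (-(x * (u * v))) g *
      ((∑ a ∈ monics F i, eFrac (u * a) g) * ∑ b ∈ monics F j, eFrac (v * b) g) =
      ∑ a ∈ monics F i, ∑ b ∈ monics F j,
        (Fintype.card F : ℂ) ^ d * (χ (c * a) * eFrac (c * (a * b)) g) := by
    have hexp : ∀ u v : F[X], χ v * eFrac (-(x * (u * v))) g *
        ((∑ a ∈ monics F i, eFrac (u * a) g) * ∑ b ∈ monics F j, eFrac (v * b) g) =
        ∑ r ∈ monics F i ×ˢ monics F j,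
          χ v * eFrac (-(x * (u * v))) g * (eFrac (u * r.1) g * eFrac (v * r.2) g) := by
      intro u v
      rw [Finset.sum_mul_sum, ← Finset.sum_product', Finset.mul_sum]
    simp only [hexp]
    rw [← Finset.sum_product', Finset.sum_comm, Finset.sum_product]
    refine Finset.sum_congr rfl fun a _ => Finset.sum_congr rfl fun b _ => ?_
    rw [← hχ.sum_sum_eFrac hg hdvd hx, Finset.sum_product]
  have hcx : χ c * χ x = 1 := hχ.map_mul_eq_one (hdvd.trans hx)
  have hfin : (Fintype.card F : ℂ) ^ d * (χ c *
      ∑ a ∈ monics F i, ∑ b ∈ monics F j, χ a * eFrac (c * (a * b)) g) =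
      (Fintype.card F : ℂ) ^ (i + j) * (topTwistSum χ (d - j) +
        dualBoxSum χ g x (d - i) (d - j)) := by
    rw [← hZ1, hZ2]
    simp only [Finset.mul_sum, hχ.2.1 c]
    exact Finset.sum_congr rfl fun a _ => Finset.sum_congr rfl fun b _ => by ring
  rw [div_mul_eq_mul_div, div_mul_eq_mul_div, eq_div_iff (pow_ne_zero _ hq)]
  linear_combination χ x * hfin - (Fintype.card F : ℂ) ^ d *
    (∑ a ∈ monics F i, ∑ b ∈ monics F j, χ a * eFrac (c * (a * b)) g) * hcx

/-- The sum over polynomials `a`, `b` with fixed degrees on the dual side. -/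
noncomputable def dualSum (χ : F[X] → ℂ) (g x : F[X]) (k₁ k₂ : ℕ) (lam : F) : ℂ :=
  ∑ b ∈ monics F k₁, ∑ a ∈ monics F k₂, χ a * eFrac (C lam * x * (a * b)) g

lemma sum_units_sum_units {χ : F[X] → ℂ} (hmul : ∀ f g, χ (f * g) = χ f * χ g)
    (W : F → ℂ) (s t : F) :
    ∑ γ₁ : Fˣ, ∑ γ₂ : Fˣ, χ (C (γ₂ : F)) * W (-((γ₁ : F) * γ₂)) *
        (eChar F (s * γ₁) * eChar F (t * γ₂)) =
      χ (-1) * ∑ lam : Fˣ, KlChi χ (-t) (s * lam) * W lam := by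
  simp only [KlChi, Finset.sum_mul, Finset.mul_sum]
  rw [Finset.sum_comm]
  refine Eq.trans ?_ Finset.sum_comm
  refine (Fintype.sum_equiv (Equiv.neg Fˣ) _ _ fun γ => ?_).symm
  refine Fintype.sum_equiv (Equiv.mulRight γ⁻¹) _ _ fun lam => ?_
  have h1 : C (((Equiv.neg Fˣ) γ : Fˣ) : F) = -1 * C (γ : F) := by simp
  have h2 : -((((Equiv.mulRight γ⁻¹) lam : Fˣ) : F) * (((Equiv.neg Fˣ) γ : Fˣ) : F)) = lam := by
    simp
  have h3 : s * (((Equiv.mulRight γ⁻¹) lam : Fˣ) : F) = s * lam * ((γ⁻¹ : Fˣ) : F) := by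
    simp [mul_assoc]
  have h4 : t * (((Equiv.neg Fˣ) γ : Fˣ) : F) = -t * γ := by simp
  rw [h1, h2, h3, h4, hmul, eChar_add]
  ring

lemma coeff_C_mul_monic {k M : ℕ} (hk : k < M) {a : F[X]} (ha : a ∈ monics F k) (γ : F) :
    (C γ * a).coeff (M - 1) = (1 - ((if M - 1 - k = 0 then 0 else 1 : ℕ) : F)) * γ := by
  rw [mem_monics] at ha
  rw [coeff_C_mul]
  split_ifs with h
  · have : M - 1 = a.natDegree := by omega
    rw [this, ha.1.coeff_natDegree]
    simp
  · rw [coeff_eq_zero_of_natDegree_lt (by omega)]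
    simp

lemma dualBoxSum_eq {χ : F[X] → ℂ} (hmul : ∀ f g, χ (f * g) = χ f * χ g) (h0 : χ 0 = 0)
    (g x : F[X]) (M₁ M₂ : ℕ) :
    dualBoxSum χ g x M₁ M₂ = χ (-1) * ∑ k₁ ∈ Finset.range M₁, ∑ k₂ ∈ Finset.range M₂,
      ∑ lam : Fˣ, KlChi χ (((if M₂ - 1 - k₂ = 0 then 0 else 1 : ℕ) : F) - 1)
        ((1 - ((if M₁ - 1 - k₁ = 0 then 0 else 1 : ℕ) : F)) * lam) *
          dualSum χ g x k₁ k₂ (lam : F) := by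
  have hv : ∀ u : F[X], ∑ v ∈ polysLT F M₂, χ v * eFrac (-(x * (u * v))) g *
      (eChar F (u.coeff (M₁ - 1)) * eChar F (v.coeff (M₂ - 1))) =
      ∑ v ∈ polysLT F M₂ \ {0}, χ v * eFrac (-(x * (u * v))) g *
      (eChar F (u.coeff (M₁ - 1)) * eChar F (v.coeff (M₂ - 1))) := by
    intro u
    refine (Finset.sum_subset Finset.sdiff_subset fun v hv hv' => ?_).symm
    have : v = 0 := by
      by_contra hne
      exact hv' (Finset.mem_sdiff.2 ⟨hv, by simpa using hne⟩)
    rw [this, h0, zero_mul, zero_mul]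
  simp only [dualBoxSum, hv, sum_polysLT_sdiff_zero]
  rw [Finset.mul_sum]
  refine Finset.sum_congr rfl fun k₁ hk₁ => ?_
  rw [Finset.mem_range] at hk₁
  refine Eq.trans ((Finset.sum_congr rfl fun γ₁ _ => Finset.sum_comm).trans Finset.sum_comm) ?_
  rw [Finset.mul_sum]
  refine Finset.sum_congr rfl fun k₂ hk₂ => ?_
  rw [Finset.mem_range] at hk₂
  have hu := sum_units_sum_units hmul (dualSum χ g x k₁ k₂)
    (1 - ((if M₁ - 1 - k₁ = 0 then 0 else 1 : ℕ) : F))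
    (1 - ((if M₂ - 1 - k₂ = 0 then 0 else 1 : ℕ) : F))
  rw [neg_sub] at hu
  rw [← hu]
  refine Finset.sum_congr rfl fun γ₁ _ => ?_
  rw [Finset.sum_comm]
  refine Finset.sum_congr rfl fun γ₂ _ => ?_
  rw [dualSum, Finset.mul_sum, Finset.sum_mul]
  refine Finset.sum_congr rfl fun b hb => ?_
  rw [Finset.mul_sum, Finset.sum_mul]
  refine Finset.sum_congr rfl fun a ha => ?_
  rw [coeff_C_mul_monic hk₁ hb, coeff_C_mul_monic hk₂ ha, hmul]
  have : -(x * (C (γ₁ : F) * b * (C (γ₂ : F) * a))) =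
      C (-((γ₁ : F) * γ₂)) * x * (a * b) := by
    rw [C_neg, C_mul]
    ring
  rw [this]
  ring

lemma sum_antidiagonal_dualBoxSum {χ : F[X] → ℂ} (hmul : ∀ f g, χ (f * g) = χ f * χ g)
    (h0 : χ 0 = 0) (g x : F[X]) (N : ℕ) :
    ∑ p ∈ Finset.HasAntidiagonal.antidiagonal N, dualBoxSum χ g x p.1 p.2 =
      χ (-1) * ∑ lam : Fˣ, ∑ η₁ ∈ Finset.range 2, ∑ η₂ ∈ Finset.range 2,
        ∑ k ∈ Finset.range (N - 1), bCoeff χ (lam : F) η₁ η₂ (N - 2 - k) *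
          ∑ f ∈ monics F k, rChi χ f * eFrac (C (lam : F) * x * f) g := by
  have hr : ∀ (lam : F) (k : ℕ), ∑ f ∈ monics F k, rChi χ f * eFrac (C lam * x * f) g =
      ∑ p ∈ Finset.HasAntidiagonal.antidiagonal k, dualSum χ g x p.2 p.1 lam := by
    intro lam k
    rw [sum_monics_rChi_mul χ (fun f => eFrac (C lam * x * f) g)]
    exact Finset.sum_congr rfl fun p _ => Finset.sum_comm
  simp only [dualBoxSum_eq hmul h0, ← Finset.mul_sum (a := χ (-1))]
  congr 1
  rw [sum_antidiagonal_range_range N fun k₁ k₂ s t => ∑ lam : Fˣ,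
    KlChi χ (((if t = 0 then 0 else 1 : ℕ) : F) - 1)
      ((1 - ((if s = 0 then 0 else 1 : ℕ) : F)) * lam) * dualSum χ g x k₁ k₂ (lam : F)]
  have hb : ∀ (lam : F) (K : ℕ), ∑ s ∈ Finset.HasAntidiagonal.antidiagonal K,
      KlChi χ (((if s.1 = 0 then 0 else 1 : ℕ) : F) - 1)
        ((1 - ((if s.2 = 0 then 0 else 1 : ℕ) : F)) * lam) =
      ∑ η₁ ∈ Finset.range 2, ∑ η₂ ∈ Finset.range 2, bCoeff χ lam η₁ η₂ K := fun lam K =>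
    sum_antidiagonal_eq_sum_negBinom K
      fun η₁ η₂ => KlChi χ ((η₁ : F) - 1) ((1 - (η₂ : F)) * lam)
  have hk : ∀ k K : ℕ, ∑ p ∈ Finset.HasAntidiagonal.antidiagonal k,
      ∑ s ∈ Finset.HasAntidiagonal.antidiagonal K, ∑ lam : Fˣ,
        KlChi χ (((if s.1 = 0 then 0 else 1 : ℕ) : F) - 1)
          ((1 - ((if s.2 = 0 then 0 else 1 : ℕ) : F)) * lam) * dualSum χ g x p.2 p.1 (lam : F) =
      ∑ lam : Fˣ, ∑ η₁ ∈ Finset.range 2, ∑ η₂ ∈ Finset.range 2, bCoeff χ (lam : F) η₁ η₂ K *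
        ∑ p ∈ Finset.HasAntidiagonal.antidiagonal k, dualSum χ g x p.2 p.1 (lam : F) := by
    intro k K
    simp only [← Finset.sum_mul, ← hb]
    rw [Finset.sum_congr rfl fun p _ => Finset.sum_comm, Finset.sum_comm]
    refine Finset.sum_congr rfl fun lam _ => ?_
    simp only [← Finset.sum_mul, ← Finset.mul_sum]
  simp only [hk, ← hr]
  rw [Finset.sum_comm]
  refine Finset.sum_congr rfl fun lam _ => ?_
  rw [Finset.sum_comm]
  exact Finset.sum_congr rfl fun η₁ _ => Finset.sum_comm

end Voronoi

/-- **Voronoi summation formula for `r_χ`, dividing-modulus case `ℓ ∣ g`.** With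
`ν = 2·deg g - n - 2`:
`Σ_{f ∈ M_n} r_χ(f)e(cf/g) = (q^n/|g|)G(χ)χ̄(c)L(1,χ̄) + (q^n/|g|)χ̄(-c)
  Σ_λ Σ_{η₁,η₂} Σ_{0 ≤ k ≤ ν} b_{ν-k}(χ;λ,η₁,η₂) Σ_{f ∈ M_k} r_χ(f)e(λc̄f/g)`,
the dual term being empty when `ν < 0`. -/
theorem voronoi_rchi_dividing
    (F : Type) [Field F] [Fintype F] (q : ℕ) (hq : q = Fintype.card F)
    (n : ℕ) (g ℓ c cbar : Polynomial F)
    (hg : g.Monic) (hgdeg : 1 ≤ g.natDegree)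
    (hℓ : ℓ.Monic) (hℓne : ℓ ≠ 1) (hdvd : ℓ ∣ g)
    (hcop : IsCoprime c g) (hcbar : g ∣ c * cbar - 1)
    (χ : Polynomial F → ℂ) (hχ : IsPrimitiveChar ℓ χ) :
    (∑ᶠ f ∈ {f : Polynomial F | f.Monic ∧ f.natDegree = n},
        rChi χ f * eFrac (c * f) g) =
      (q : ℂ) ^ n / (q : ℂ) ^ g.natDegree * GSum ℓ χ * conjChar χ c *
          LFun (conjChar χ) 1 +
      (q : ℂ) ^ n / (q : ℂ) ^ g.natDegree * conjChar χ (-c) *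
        ∑ lam : Fˣ, ∑ η₁ ∈ Finset.range 2, ∑ η₂ ∈ Finset.range 2,
          ∑ k ∈ Finset.range (2 * (g.natDegree : ℤ) - (n : ℤ) - 2 + 1).toNat,
            bCoeff χ (lam : F) η₁ η₂
                (2 * (g.natDegree : ℤ) - (n : ℤ) - 2 - (k : ℤ)).toNat *
              ∑ᶠ f ∈ {f : Polynomial F | f.Monic ∧ f.natDegree = k},
                rChi χ f * eFrac (Polynomial.C (lam : F) * cbar * f) g := by
  have hχ1 := hχ.1
  have h0 := hχ1.map_zero hℓ hℓne
  set d := g.natDegree with hd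
  have hrange : (2 * (d : ℤ) - (n : ℤ) - 2 + 1).toNat = 2 * d - n - 1 := by omega
  have hindex : ∀ k : ℕ, (2 * (d : ℤ) - (n : ℤ) - 2 - (k : ℤ)).toNat = 2 * d - n - 2 - k := by
    intro k
    omega
  have hcc : conjChar χ c = χ cbar := hχ1.conjChar_eq hℓ (hdvd.trans hcbar)
  have hcneg : conjChar χ (-c) = χ cbar * χ (-1) := by
    rw [hχ1.conjChar_eq hℓ (b := cbar * -1), hχ1.2.1]
    have : -c * (cbar * -1) - 1 = c * cbar - 1 := by ring
    rw [this]
    exact hdvd.trans hcbar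
  have hdual := sum_antidiagonal_dualBoxSum hχ1.2.1 h0 g cbar (2 * d - n)
  have hvanish := sum_antidiagonal_eq_of_vanish (dualBoxSum χ g cbar) (topTwistSum χ) d n
    (dualBoxSum_zero_left χ g cbar) (dualBoxSum_zero_right h0 g cbar)
    (fun _ _ h => dualBoxSum_of_lt_right hχ1 hg hdvd cbar h)
    (fun _ _ h => dualBoxSum_of_lt_left χ hg cbar h)
  have htop := sum_antidiagonal_sub (topTwistSum χ) (topTwistSum_zero h0) d n
  rw [hχ.sum_topTwistSum hℓ hℓne (natDegree_le_of_dvd hdvd hg.ne_zero)] at htop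
  simp only [finsum_monics, hrange, hindex, hcc, hcneg]
  rw [sum_monics_rChi_mul χ (fun f => eFrac (c * f) g),
    Finset.sum_congr rfl fun p hp => by
      rw [hχ1.sum_monics_sum_monics hg hdvd hcbar p.1 p.2,
        Finset.HasAntidiagonal.mem_antidiagonal.1 hp],
    ← Finset.mul_sum, Finset.sum_add_distrib, hq, ← hd]
  linear_combination ((Fintype.card F : ℂ) ^ n / (Fintype.card F : ℂ) ^ d * χ cbar) *
    (htop - hvanish + hdual)
end
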